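/- For every real C₀ ≥ 1 there exists a constant C > 0, depending only on C₀, with the following property. Let Q ≥ 3 and R ≥ 2 be reals, let 2 ≤ w < y ≤ x be reals satisfying Q·R ≤ x ≤ Q^{C₀} and log(x/w) ≤ C₀·log(y/w), and let α be real with 3/4 ≤ α < 1. Then log(Qx)·(1 + log(log x / log(QR)))·∑_{w ≤ n ≤ x} Δ(n)²·e^{−2n(log Q)²/x}·n^{1−2α} ≤ C·(log Q)·x^{2(1−α)}. -/

import Mathlib

open scoped BigOperators

/-- The Selberg weight profile `m(d)`. -/
noncomputable def selbergM (w y : ℝ) (d : ℕ) : ℝ :=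
  if (d : ℝ) ≤ w then 1
  else if (d : ℝ) ≤ y then Real.log (y / d) / Real.log (y / w)
  else 0

/-- The Selberg weight `λ_d = μ(d)·m(d)`. -/
noncomputable def selbergLambda (w y : ℝ) (d : ℕ) : ℝ :=
  ((ArithmeticFunction.moebius d : ℤ) : ℝ) * selbergM w y d

/-- `Δ(n) = ∑_{d ∣ n} λ_d`. -/
noncomputable def selbergDelta (w y : ℝ) (n : ℕ) : ℝ :=
  ∑ d ∈ n.divisors, selbergLambda w y d

namespace BarbanVehov

open Finset Real
open scoped ArithmeticFunction.Moebius Pointwise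

/-- The sum of a function over the multiples of `m` up to `N`. -/
lemma sum_Icc_filter_dvd {m : ℕ} (hm : m ≠ 0) (N : ℕ) (f : ℕ → ℝ) :
    ∑ n ∈ Icc 1 N with m ∣ n, f n = ∑ j ∈ Icc 1 (N / m), f (m * j) := by
  symm
  refine sum_bij (fun j _ => m * j) ?_ ?_ ?_ ?_
  · intro j hj
    simp only [mem_Icc, mem_filter] at hj ⊢
    have h1 : m * j ≤ N := by
      rw [mul_comm]; exact (Nat.le_div_iff_mul_le (Nat.pos_of_ne_zero hm)).1 hj.2
    exact ⟨⟨Nat.mul_pos (Nat.pos_of_ne_zero hm) hj.1, h1⟩, dvd_mul_right _ _⟩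
  · intro a _ b _ h
    exact Nat.eq_of_mul_eq_mul_left (Nat.pos_of_ne_zero hm) h
  · intro n hn
    simp only [mem_Icc, mem_filter] at hn
    obtain ⟨⟨h1, h2⟩, j, rfl⟩ := hn
    refine ⟨j, ?_, rfl⟩
    simp only [mem_Icc]
    refine ⟨Nat.pos_of_ne_zero (by rintro rfl; simp at h1), ?_⟩
    rw [Nat.le_div_iff_mul_le (Nat.pos_of_ne_zero hm), mul_comm]; exact h2
  · intros; rfl

lemma sum_mul_sum_divisors (N : ℕ) (a b : ℕ → ℝ) :
    ∑ n ∈ Icc 1 N, b n * ∑ m ∈ n.divisors, a m =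
      ∑ m ∈ Icc 1 N, a m * ∑ n ∈ Icc 1 N with m ∣ n, b n := by
  simp_rw [mul_sum]
  rw [sum_comm' (t' := Icc 1 N) (s' := fun m => {n ∈ Icc 1 N | m ∣ n})]
  · exact sum_congr rfl fun m _ => sum_congr rfl fun n _ => mul_comm _ _
  · intro n m
    simp only [mem_Icc, Nat.mem_divisors, mem_filter]
    constructor
    · rintro ⟨⟨h1, h2⟩, h3, h4⟩
      exact ⟨⟨⟨h1, h2⟩, h3⟩, Nat.pos_of_dvd_of_pos h3 h1, (Nat.le_of_dvd h1 h3).trans h2⟩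
    · rintro ⟨⟨⟨h1, h2⟩, h3⟩, _⟩
      exact ⟨⟨h1, h2⟩, h3, by omega⟩

lemma abs_sum_inv_sub_log_le {u : ℝ} (hu : 1 ≤ u) :
    |∑ j ∈ Icc 1 ⌊u⌋₊, (j : ℝ)⁻¹ - (log u + eulerMascheroniConstant)| ≤ 2 / u := by
  set n := ⌊u⌋₊ with hn
  have hn1 : 1 ≤ n := (Nat.one_le_floor_iff u).2 hu
  have hn0 : (0 : ℝ) < n := by exact_mod_cast hn1
  have hnu : (n : ℝ) ≤ u := Nat.floor_le (by linarith)
  have hun : u < n + 1 := Nat.lt_floor_add_one u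
  have hH : ∑ j ∈ Icc 1 n, (j : ℝ)⁻¹ = (harmonic n : ℝ) := by
    rw [harmonic_eq_sum_Icc]; push_cast; rfl
  rw [hH]
  have h1 := eulerMascheroniSeq_lt_eulerMascheroniConstant n
  have h2 := eulerMascheroniConstant_lt_eulerMascheroniSeq' n
  rw [eulerMascheroniSeq] at h1
  rw [eulerMascheroniSeq', if_neg (by omega)] at h2
  have h3 : log n ≤ log u := log_le_log hn0 hnu
  have h4 : log u ≤ log (n + 1) := log_le_log (by linarith) hun.le
  have h5 : log (n + 1) - log n ≤ 1 / n := by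
    rw [← log_div (by positivity) (by positivity)]
    have := log_le_sub_one_of_pos (x := ((n : ℝ) + 1) / n) (by positivity)
    have e : ((n : ℝ) + 1) / n - 1 = 1 / n := by field_simp; ring
    linarith
  have h6 : (1 : ℝ) / n ≤ 2 / u := by
    rw [div_le_div_iff₀ hn0 (by linarith)]
    have : (1 : ℝ) ≤ n := by exact_mod_cast hn1
    linarith
  rw [abs_le]; constructor <;> linarith

lemma exists_mul_primeFactors_subset_coprime {k : ℕ} (hk : k ≠ 0) {n : ℕ} (hn : n ≠ 0) :
    ∃ a b, n = a * b ∧ a.primeFactors ⊆ k.primeFactors ∧ b.Coprime k := by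
  induction n using Nat.recOnMul with
  | zero => exact absurd rfl hn
  | one => exact ⟨1, 1, by simp⟩
  | prime p hp =>
    by_cases h : p ∣ k
    · exact ⟨p, 1, by simp, by simp [hp, h, hk], by simp⟩
    · exact ⟨1, p, by simp, by simp, (Nat.Prime.coprime_iff_not_dvd hp).2 h⟩
  | mul a b iha ihb =>
    obtain ⟨a₁, b₁, rfl, ha₁, hb₁⟩ := iha (left_ne_zero_of_mul hn)
    obtain ⟨a₂, b₂, rfl, ha₂, hb₂⟩ := ihb (right_ne_zero_of_mul hn)
    refine ⟨a₁ * a₂, b₁ * b₂, by ring, ?_, Nat.Coprime.mul_left hb₁ hb₂⟩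
    rw [Nat.primeFactors_mul (by rintro rfl; simp at hn) (by rintro rfl; simp at hn)]
    exact union_subset ha₁ ha₂

lemma sum_divisors_moebius (n : ℕ) :
    ∑ d ∈ n.divisors, (μ d : ℝ) = if n = 1 then 1 else 0 := by
  have h := congrArg (fun f : ArithmeticFunction ℝ => f n)
    (ArithmeticFunction.coe_moebius_mul_coe_zeta (R := ℝ))
  simp only [ArithmeticFunction.coe_mul_zeta_apply, ArithmeticFunction.one_apply] at h
  simpa using h

lemma sum_divisors_coprime_moebius {k : ℕ} (hk : k ≠ 0) {n : ℕ} (hn : n ≠ 0) :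
    ∑ d ∈ n.divisors, (if d.Coprime k then (μ d : ℝ) else 0) =
      if n.primeFactors ⊆ k.primeFactors then 1 else 0 := by
  obtain ⟨a, b, rfl, ha, hb⟩ := exists_mul_primeFactors_subset_coprime hk hn
  have ha0 := left_ne_zero_of_mul hn
  have hb0 := right_ne_zero_of_mul hn
  have hdiv : (a * b).divisors.filter (fun d => d.Coprime k) = b.divisors := by
    ext d
    simp only [mem_filter, Nat.mem_divisors]
    constructor
    · rintro ⟨⟨h1, _⟩, h2⟩
      refine ⟨Nat.Coprime.dvd_of_dvd_mul_left (k := d) (m := a) ?_ h1, hb0⟩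
      refine Nat.Coprime.symm (Nat.coprime_of_dvd fun p hp hpa hpd => ?_)
      have : p ∈ k.primeFactors := ha (Nat.mem_primeFactors.2 ⟨hp, hpa, ha0⟩)
      exact Nat.Prime.one_lt hp |>.ne' (Nat.eq_one_of_dvd_coprimes h2 hpd
        (Nat.dvd_of_mem_primeFactors this))
    · rintro ⟨h1, _⟩
      exact ⟨⟨h1.mul_left a, hn⟩, Nat.Coprime.of_dvd_left h1 hb⟩
  rw [← sum_filter, hdiv, sum_divisors_moebius b]
  congr 1
  rw [Nat.primeFactors_mul ha0 hb0]
  apply propext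
  constructor
  · rintro rfl; simpa using ha
  · intro h
    by_contra hb1
    obtain ⟨p, hp, hpb⟩ := Nat.exists_prime_and_dvd hb1
    have : p ∈ k.primeFactors :=
      h (mem_union_right _ (Nat.mem_primeFactors.2 ⟨hp, hpb, hb0⟩))
    exact Nat.Prime.one_lt hp |>.ne' (Nat.eq_one_of_dvd_coprimes hb hpb
        (Nat.dvd_of_mem_primeFactors this))

/-- The Euler product `∏ (1 - 1/p)⁻¹` over the primes in a finite set. -/
noncomputable def eulerProd (s : Finset ℕ) : ℝ := ∏ p ∈ s with p.Prime, (1 - (p : ℝ)⁻¹)⁻¹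

/-- `n ↦ n⁻¹` as a completely multiplicative function. -/
noncomputable def invHom : ℕ →* ℝ where
  toFun n := (n : ℝ)⁻¹
  map_one' := by simp
  map_mul' := by intros; push_cast; rw [mul_inv]

lemma hasSum_factoredNumbers (s : Finset ℕ) :
    HasSum (fun m : Nat.factoredNumbers s => ((m : ℕ) : ℝ)⁻¹) (eulerProd s) := by
  refine (EulerProduct.summable_and_hasSum_factoredNumbers_prod_filter_prime_geometric
    (f := invHom) ?_ s).2
  intro p hp
  have : (1 : ℝ) < p := by exact_mod_cast hp.one_lt
  simp only [invHom, MonoidHom.coe_mk, OneHom.coe_mk, norm_inv, RCLike.norm_natCast]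
  exact inv_lt_one_of_one_lt₀ this

lemma sum_inv_le_eulerProd (s T : Finset ℕ) (hT : ∀ n ∈ T, n ∈ Nat.factoredNumbers s) :
    ∑ n ∈ T, (n : ℝ)⁻¹ ≤ eulerProd s := by
  classical
  have h := hasSum_factoredNumbers s
  have := sum_le_hasSum (T.subtype (· ∈ Nat.factoredNumbers s)) (fun _ _ => by positivity) h
  rwa [sum_subtype_of_mem (fun n : ℕ => (n : ℝ)⁻¹) hT] at this

lemma one_le_eulerProd (s : Finset ℕ) : 1 ≤ eulerProd s := by
  have := sum_inv_le_eulerProd s {1} (by simp [Nat.mem_factoredNumbers_iff_primeFactors_subset])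
  simpa using this

/-- The elementary bound for `∑ μ(m) / m * log (t / m)` over `m` coprime to `k`. -/
lemma abs_sum_coprime_moebius_log_le {k : ℕ} (hk : k ≠ 0) {t : ℝ} (ht : 0 ≤ t) {M : ℕ}
    (hM : ⌊t⌋₊ ≤ M) :
    |∑ m ∈ Icc 1 M, (if m.Coprime k then (μ m : ℝ) else 0) / m * log⁺ (t / m)| ≤
      5 * eulerProd k.primeFactors := by
  have hP := one_le_eulerProd k.primeFactors
  have hcut : ∑ m ∈ Icc 1 M, (if m.Coprime k then (μ m : ℝ) else 0) / m * log⁺ (t / m) =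
      ∑ m ∈ Icc 1 ⌊t⌋₊, (if m.Coprime k then (μ m : ℝ) else 0) / m * log⁺ (t / m) := by
    symm
    apply sum_subset (Icc_subset_Icc_right hM)
    intro m hm hm'
    simp only [mem_Icc, not_and, not_le] at hm hm'
    have h1 : t < m := (Nat.floor_lt ht).1 (hm' hm.1)
    have : log⁺ (t / m) = 0 := by
      rw [posLog_eq_zero_iff, abs_of_nonneg (by positivity)]
      exact div_le_one_of_le₀ h1.le (by positivity)
    rw [this, mul_zero]
  rw [hcut]
  rcases lt_or_ge t 1 with ht1 | ht1
  · rw [Nat.floor_eq_zero.2 ht1]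
    simp; linarith
  set N := ⌊t⌋₊ with hN
  set a : ℕ → ℝ := fun m => if m.Coprime k then (μ m : ℝ) else 0 with ha
  have hNt : (N : ℝ) ≤ t := Nat.floor_le ht
  have ha1 : ∀ m, |a m| ≤ 1 := by
    intro m
    simp only [ha]
    split_ifs
    · exact_mod_cast ArithmeticFunction.abs_moebius_le_one
    · simp
  have hc : ∀ n ∈ Icc 1 N, 0 ≤ ∑ d ∈ n.divisors, a d ∧ ∑ d ∈ n.divisors, a d ≤ 1 := by
    intro n hn
    rw [sum_divisors_coprime_moebius hk (by simp at hn; omega)]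
    split_ifs <;> simp
  have hfl : ∀ m : ℕ, ⌊t / m⌋₊ = N / m := fun m => Nat.floor_div_natCast t m
  -- the counting identity
  have hB := sum_mul_sum_divisors N a (fun _ => 1)
  have hB1 : |∑ m ∈ Icc 1 N, a m * ((N / m : ℕ) : ℝ)| ≤ t := by
    have e : ∑ m ∈ Icc 1 N, a m * ((N / m : ℕ) : ℝ) = ∑ n ∈ Icc 1 N, ∑ d ∈ n.divisors, a d := by
      simp only [one_mul] at hB
      rw [hB]
      refine sum_congr rfl fun m hm => ?_
      rw [sum_Icc_filter_dvd (by simp at hm; omega)]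
      simp
    rw [e, abs_of_nonneg (sum_nonneg fun n hn => (hc n hn).1)]
    calc _ ≤ ∑ n ∈ Icc 1 N, (1 : ℝ) := sum_le_sum fun n hn => (hc n hn).2
      _ ≤ t := by simpa using hNt
  have hB2 : |∑ m ∈ Icc 1 N, a m / m| ≤ 2 := by
    have e : t * ∑ m ∈ Icc 1 N, a m / m = ∑ m ∈ Icc 1 N, a m * ((N / m : ℕ) : ℝ) +
        ∑ m ∈ Icc 1 N, a m * (t / m - ((N / m : ℕ) : ℝ)) := by
      rw [mul_sum, ← sum_add_distrib]
      exact sum_congr rfl fun m _ => by ring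
    have h2 : |∑ m ∈ Icc 1 N, a m * (t / m - ((N / m : ℕ) : ℝ))| ≤ t := by
      calc _ ≤ ∑ m ∈ Icc 1 N, |a m * (t / m - ((N / m : ℕ) : ℝ))| := abs_sum_le_sum_abs _ _
        _ ≤ ∑ m ∈ Icc 1 N, (1 : ℝ) := by
          refine sum_le_sum fun m _ => ?_
          rw [abs_mul, ← hfl m]
          have h3 : (⌊t / m⌋₊ : ℝ) ≤ t / m := Nat.floor_le (by positivity)
          have h4 : t / m < ⌊t / m⌋₊ + 1 := Nat.lt_floor_add_one _
          have h5 : |t / m - ⌊t / m⌋₊| ≤ 1 := by rw [abs_le]; constructor <;> linarith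
          exact mul_le_one₀ (ha1 m) (abs_nonneg _) h5
        _ ≤ t := by simpa using hNt
    have h3 : t * |∑ m ∈ Icc 1 N, a m / m| ≤ t * 2 := by
      rw [← abs_of_nonneg ht, ← abs_mul, abs_of_nonneg ht, e]
      exact (abs_add_le _ _).trans (by linarith)
    exact le_of_mul_le_mul_left h3 (by linarith)
  -- the harmonic identity
  have hA := sum_mul_sum_divisors N a (fun n => (n : ℝ)⁻¹)
  have hA1 : |∑ m ∈ Icc 1 N, a m / m * ∑ j ∈ Icc 1 (N / m), (j : ℝ)⁻¹| ≤
      eulerProd k.primeFactors := by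
    have e : ∑ m ∈ Icc 1 N, a m / m * ∑ j ∈ Icc 1 (N / m), (j : ℝ)⁻¹ =
        ∑ n ∈ Icc 1 N, (n : ℝ)⁻¹ * ∑ d ∈ n.divisors, a d := by
      rw [hA]
      refine sum_congr rfl fun m hm => ?_
      rw [sum_Icc_filter_dvd (by simp at hm; omega), div_mul_eq_mul_div, mul_div_assoc, sum_div]
      refine congrArg _ (sum_congr rfl fun j _ => ?_)
      push_cast
      rw [mul_inv]; ring
    rw [e, abs_of_nonneg (sum_nonneg fun n hn => mul_nonneg (by positivity) (hc n hn).1)]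
    have : ∑ n ∈ Icc 1 N, (n : ℝ)⁻¹ * ∑ d ∈ n.divisors, a d =
        ∑ n ∈ Icc 1 N with n.primeFactors ⊆ k.primeFactors, (n : ℝ)⁻¹ := by
      rw [sum_filter]
      refine sum_congr rfl fun n hn => ?_
      rw [sum_divisors_coprime_moebius hk (by simp at hn; omega)]
      split_ifs <;> simp
    rw [this]
    refine sum_inv_le_eulerProd _ _ fun n hn => ?_
    simp only [mem_filter, mem_Icc] at hn
    exact Nat.mem_factoredNumbers_of_primeFactors_subset (by omega) hn.2
  -- comparison
  have hD : |∑ m ∈ Icc 1 N, a m / m * (∑ j ∈ Icc 1 (N / m), (j : ℝ)⁻¹ -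
      (log (t / m) + eulerMascheroniConstant))| ≤ 2 := by
    calc _ ≤ ∑ m ∈ Icc 1 N, |a m / m * (∑ j ∈ Icc 1 (N / m), (j : ℝ)⁻¹ -
          (log (t / m) + eulerMascheroniConstant))| := abs_sum_le_sum_abs _ _
      _ ≤ ∑ m ∈ Icc 1 N, 2 / t := by
        refine sum_le_sum fun m hm => ?_
        simp only [mem_Icc] at hm
        have hm0 : (0 : ℝ) < m := by exact_mod_cast hm.1
        have hmt : (m : ℝ) ≤ t := (Nat.le_floor_iff ht).1 hm.2
        have h1 : 1 ≤ t / m := (one_le_div hm0).2 hmt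
        have h2 := abs_sum_inv_sub_log_le h1
        rw [hfl m] at h2
        rw [abs_mul, abs_div, abs_of_pos hm0]
        calc |a m| / m * _ ≤ 1 / m * (2 / (t / m)) :=
              mul_le_mul (by gcongr; exact ha1 m) h2 (abs_nonneg _) (by positivity)
          _ = 2 / t := by field_simp
      _ ≤ 2 := by
        rw [sum_const, Nat.card_Icc, nsmul_eq_mul, mul_div_assoc', div_le_iff₀ (by linarith)]
        push_cast [Nat.add_sub_cancel]; linarith
  have hfin : ∑ m ∈ Icc 1 N, a m / m * log⁺ (t / m) =
      ∑ m ∈ Icc 1 N, a m / m * ∑ j ∈ Icc 1 (N / m), (j : ℝ)⁻¹ -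
      ∑ m ∈ Icc 1 N, a m / m * (∑ j ∈ Icc 1 (N / m), (j : ℝ)⁻¹ -
      (log (t / m) + eulerMascheroniConstant)) -
      eulerMascheroniConstant * ∑ m ∈ Icc 1 N, a m / m := by
    rw [mul_sum, ← sum_sub_distrib, ← sum_sub_distrib]
    refine sum_congr rfl fun m hm => ?_
    simp only [mem_Icc] at hm
    have hm0 : (0 : ℝ) < m := by exact_mod_cast hm.1
    have hmt : (m : ℝ) ≤ t := (Nat.le_floor_iff ht).1 hm.2
    rw [posLog_eq_log (by rw [abs_of_nonneg (by positivity)]; exact (one_le_div hm0).2 hmt)]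
    ring
  rw [hfin]
  have hγ1 := one_half_lt_eulerMascheroniConstant
  have hγ2 := eulerMascheroniConstant_lt_two_thirds
  rw [abs_le] at *
  constructor <;> nlinarith

lemma sum_card_divisors_mul_le (N : ℕ) {g : ℕ → ℝ} (hg0 : ∀ n, 0 ≤ g n)
    (hg : ∀ a b, g (a * b) ≤ g a * g b) :
    ∑ n ∈ Icc 1 N, (#n.divisors : ℝ) * g n ≤ (∑ n ∈ Icc 1 N, g n) ^ 2 := by
  have h := sum_mul_sum_divisors N (fun _ => 1) g
  have e : ∑ n ∈ Icc 1 N, (#n.divisors : ℝ) * g n = ∑ n ∈ Icc 1 N, g n * ∑ m ∈ n.divisors, 1 := by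
    refine sum_congr rfl fun n _ => ?_
    rw [sum_const, nsmul_eq_mul]; ring
  rw [e, h, sq, sum_mul]
  refine sum_le_sum fun m hm => ?_
  simp only [mem_Icc] at hm
  rw [sum_Icc_filter_dvd (by omega), one_mul]
  calc ∑ j ∈ Icc 1 (N / m), g (m * j) ≤ ∑ j ∈ Icc 1 (N / m), g m * g j :=
        sum_le_sum fun j _ => hg m j
    _ = g m * ∑ j ∈ Icc 1 (N / m), g j := by rw [mul_sum]
    _ ≤ _ := by
      refine mul_le_mul_of_nonneg_left ?_ (hg0 m)
      exact sum_le_sum_of_subset_of_nonneg (Icc_subset_Icc_right (Nat.div_le_self _ _))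
        fun _ _ _ => hg0 _

lemma card_divisors_mul_le (a b : ℕ) :
    (#(a * b).divisors : ℝ) ≤ #a.divisors * #b.divisors := by
  rw [Nat.divisors_mul]
  exact_mod_cast card_mul_le

lemma sum_inv_sq_le (N : ℕ) : ∑ n ∈ Icc 1 N, ((n : ℝ) ^ 2)⁻¹ ≤ 2 := by
  have h : ∀ N : ℕ, ∑ n ∈ Icc 1 (N + 1), ((n : ℝ) ^ 2)⁻¹ ≤ 2 - 1 / (N + 1) := by
    intro N
    induction N with
    | zero => norm_num
    | succ N ih =>
      rw [sum_Icc_succ_top (by omega)]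
      have : (((N + 1 + 1 : ℕ) : ℝ) ^ 2)⁻¹ ≤ 1 / ((N : ℝ) + 1) - 1 / (N + 1 + 1) := by
        push_cast
        rw [div_sub_div _ _ (by positivity) (by positivity), inv_eq_one_div,
          div_le_div_iff₀ (by positivity) (by positivity)]
        nlinarith
      push_cast at *
      linarith
  cases N with
  | zero => norm_num
  | succ N =>
    have := h N
    have h2 : (0 : ℝ) ≤ 1 / (N + 1) := by positivity
    linarith

lemma sum_inv_le (N : ℕ) : ∑ n ∈ Icc 1 N, (n : ℝ)⁻¹ ≤ 1 + log N := by
  have h := harmonic_le_one_add_log N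
  rw [harmonic_eq_sum_Icc] at h
  push_cast at h
  exact h

/-- `n ↦ τ(n) / n` as an arithmetic function. -/
noncomputable def divisorDensity : ArithmeticFunction ℝ :=
  ⟨fun n => (#n.divisors : ℝ) * (n : ℝ)⁻¹, by simp⟩

lemma divisorDensity_apply (n : ℕ) : divisorDensity n = (#n.divisors : ℝ) * (n : ℝ)⁻¹ := rfl

lemma isMultiplicative_divisorDensity : divisorDensity.IsMultiplicative := by
  refine ⟨by simp [divisorDensity_apply], fun {m n} h => ?_⟩
  simp only [divisorDensity_apply]
  rw [h.card_divisors_mul]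
  push_cast
  rw [mul_inv]; ring

lemma eulerProd_primeFactors_le {k : ℕ} (hk : Squarefree k) :
    eulerProd k.primeFactors ≤ ∑ j ∈ k.divisors, (#j.divisors : ℝ) * (j : ℝ)⁻¹ := by
  have h := isMultiplicative_divisorDensity.prodPrimeFactors_one_add_of_squarefree hk
  simp only [divisorDensity_apply] at h
  rw [← h, eulerProd, filter_true_of_mem fun p hp => Nat.prime_of_mem_primeFactors hp]
  have key : ∀ p ∈ k.primeFactors, (0 : ℝ) < 1 - (p : ℝ)⁻¹ ∧
      (1 - (p : ℝ)⁻¹)⁻¹ ≤ 1 + (#p.divisors : ℝ) * (p : ℝ)⁻¹ := by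
    intro p hp
    have hp := Nat.prime_of_mem_primeFactors hp
    have h2 : (2 : ℝ) ≤ p := by exact_mod_cast hp.two_le
    have h3 : (p : ℝ)⁻¹ ≤ 2⁻¹ := inv_anti₀ (by norm_num) h2
    have h4 : (0 : ℝ) < (p : ℝ)⁻¹ := by positivity
    refine ⟨by linarith, ?_⟩
    rw [hp.divisors, card_pair hp.one_lt.ne, inv_le_iff_one_le_mul₀ (by linarith)]
    push_cast
    nlinarith
  exact prod_le_prod (fun p hp => (inv_pos.2 (key p hp).1).le) fun p hp => (key p hp).2

lemma sum_card_divisors_div_sq_le (N : ℕ) :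
    ∑ j ∈ Icc 1 N, (#j.divisors : ℝ) * ((j : ℝ) ^ 2)⁻¹ ≤ 4 := by
  have h := sum_card_divisors_mul_le N (g := fun n => ((n : ℝ) ^ 2)⁻¹) (fun _ => by positivity)
    (fun a b => by push_cast; rw [mul_pow, mul_inv])
  have h2 := sum_inv_sq_le N
  have h3 : 0 ≤ ∑ n ∈ Icc 1 N, ((n : ℝ) ^ 2)⁻¹ := sum_nonneg fun _ _ => by positivity
  nlinarith

lemma sum_eulerProd_div_le (N : ℕ) :
    ∑ k ∈ Icc 1 N with Squarefree k, eulerProd k.primeFactors / k ≤ 4 * (1 + log N) := by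
  have hlog : 0 ≤ log (N : ℝ) := log_natCast_nonneg N
  calc ∑ k ∈ Icc 1 N with Squarefree k, eulerProd k.primeFactors / k
      ≤ ∑ k ∈ Icc 1 N with Squarefree k,
          (k : ℝ)⁻¹ * ∑ j ∈ k.divisors, (#j.divisors : ℝ) * (j : ℝ)⁻¹ := by
        refine sum_le_sum fun k hk => ?_
        rw [div_eq_inv_mul]
        exact mul_le_mul_of_nonneg_left (eulerProd_primeFactors_le (mem_filter.1 hk).2)
          (by positivity)
    _ ≤ ∑ k ∈ Icc 1 N, (k : ℝ)⁻¹ * ∑ j ∈ k.divisors, (#j.divisors : ℝ) * (j : ℝ)⁻¹ :=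
        sum_le_sum_of_subset_of_nonneg (filter_subset _ _) fun _ _ _ => by positivity
    _ = ∑ m ∈ Icc 1 N, (#m.divisors : ℝ) * (m : ℝ)⁻¹ * ∑ n ∈ Icc 1 N with m ∣ n, (n : ℝ)⁻¹ :=
        sum_mul_sum_divisors N _ _
    _ ≤ ∑ m ∈ Icc 1 N, (#m.divisors : ℝ) * ((m : ℝ) ^ 2)⁻¹ * (1 + log N) := by
        refine sum_le_sum fun m hm => ?_
        simp only [mem_Icc] at hm
        rw [sum_Icc_filter_dvd (by omega)]
        have e : ∑ j ∈ Icc 1 (N / m), ((m * j : ℕ) : ℝ)⁻¹ =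
            (m : ℝ)⁻¹ * ∑ j ∈ Icc 1 (N / m), (j : ℝ)⁻¹ := by
          rw [mul_sum]
          exact sum_congr rfl fun j _ => by push_cast; rw [mul_inv]
        have h1 : ∑ j ∈ Icc 1 (N / m), (j : ℝ)⁻¹ ≤ 1 + log N :=
          (sum_le_sum_of_subset_of_nonneg (Icc_subset_Icc_right (Nat.div_le_self _ _))
            fun _ _ _ => by positivity).trans (sum_inv_le N)
        rw [e]
        calc (#m.divisors : ℝ) * (m : ℝ)⁻¹ * ((m : ℝ)⁻¹ * ∑ j ∈ Icc 1 (N / m), (j : ℝ)⁻¹)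
            = (#m.divisors : ℝ) * ((m : ℝ) ^ 2)⁻¹ * ∑ j ∈ Icc 1 (N / m), (j : ℝ)⁻¹ := by
              rw [sq, mul_inv]; ring
          _ ≤ _ := mul_le_mul_of_nonneg_left h1 (by positivity)
    _ ≤ 4 * (1 + log N) := by
        rw [← sum_mul]
        exact mul_le_mul_of_nonneg_right (sum_card_divisors_div_sq_le N) (by linarith)

lemma moebius_mul_eq (k m : ℕ) :
    (μ (k * m) : ℝ) = μ k * if m.Coprime k then (μ m : ℝ) else 0 := by
  split_ifs with h
  · exact_mod_cast ArithmeticFunction.isMultiplicative_moebius.map_mul_of_coprime h.symm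
  · rw [mul_zero, ArithmeticFunction.moebius_eq_zero_of_not_squarefree]
    · simp
    · intro hs
      exact h (Nat.squarefree_mul_iff.1 hs).1.symm

lemma totient_mul_eulerProd (k : ℕ) : (k.totient : ℝ) * eulerProd k.primeFactors = k := by
  have h := Nat.totient_eq_mul_prod_factors k
  have h' : (k.totient : ℝ) = k * ∏ p ∈ k.primeFactors, (1 - (p : ℝ)⁻¹) := by
    have := congrArg (fun q : ℚ => (q : ℝ)) h
    push_cast at this
    exact this
  rw [h', eulerProd, filter_true_of_mem fun p hp => Nat.prime_of_mem_primeFactors hp, mul_assoc,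
    ← prod_mul_distrib, prod_eq_one, mul_one]
  intro p hp
  have h2 : (1 : ℝ) < p := by exact_mod_cast (Nat.prime_of_mem_primeFactors hp).one_lt
  have := inv_lt_one_of_one_lt₀ h2
  exact mul_inv_cancel₀ (by linarith)

/-- The diagonal form of a quadratic form with coefficients `1 / [d, e]`. -/
lemma sum_sum_div_lcm (M : ℕ) (x : ℕ → ℝ) :
    ∑ d ∈ Icc 1 M, ∑ e ∈ Icc 1 M, x d * x e / (d.lcm e : ℕ) =
      ∑ k ∈ Icc 1 M, (k.totient : ℝ) * (∑ d ∈ Icc 1 M with k ∣ d, x d / d) ^ 2 := by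
  have h1 : ∀ d ∈ Icc 1 M, ∀ e ∈ Icc 1 M, x d * x e / (d.lcm e : ℕ) =
      ∑ k ∈ Icc 1 M, (k.totient : ℝ) *
        ((if k ∣ d then x d / d else 0) * (if k ∣ e then x e / e else 0)) := by
    intro d hd e he
    simp only [mem_Icc] at hd he
    have hd0 : (d : ℝ) ≠ 0 := by norm_cast; omega
    have he0 : (e : ℝ) ≠ 0 := by norm_cast; omega
    have hg : ((d.gcd e : ℕ) : ℝ) * (d.lcm e : ℕ) = d * e := by exact_mod_cast Nat.gcd_mul_lcm d e
    have hgpos : 0 < d.gcd e := Nat.gcd_pos_of_pos_left _ (by omega)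
    have hl0 : ((d.lcm e : ℕ) : ℝ) ≠ 0 := by
      intro h0; rw [h0, mul_zero] at hg; exact mul_ne_zero hd0 he0 hg.symm
    have hs : ((d.gcd e : ℕ) : ℝ) =
        ∑ k ∈ Icc 1 M, if k ∣ d ∧ k ∣ e then (k.totient : ℝ) else 0 := by
      rw [← sum_filter]
      have : {k ∈ Icc 1 M | k ∣ d ∧ k ∣ e} = (d.gcd e).divisors := by
        ext k
        simp only [mem_filter, mem_Icc, Nat.mem_divisors, Nat.dvd_gcd_iff]
        constructor
        · rintro ⟨_, h⟩; exact ⟨h, hgpos.ne'⟩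
        · rintro ⟨h, _⟩
          exact ⟨⟨Nat.pos_of_dvd_of_pos h.1 (by omega),
            (Nat.le_of_dvd (by omega) h.1).trans hd.2⟩, h⟩
      rw [this]
      exact_mod_cast (Nat.sum_totient _).symm
    have : x d * x e / (d.lcm e : ℕ) = (d.gcd e : ℕ) * (x d / d * (x e / e)) := by
      field_simp
      linear_combination (-(x d * x e)) * hg
    rw [this, hs, sum_mul]
    refine sum_congr rfl fun k _ => ?_
    by_cases h1 : k ∣ d <;> by_cases h2 : k ∣ e <;> simp [h1, h2]
  rw [sum_congr rfl fun d hd => sum_congr rfl fun e he => h1 d hd e he]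
  have h2 : ∀ d ∈ Icc 1 M, ∑ e ∈ Icc 1 M, ∑ k ∈ Icc 1 M, (k.totient : ℝ) *
        ((if k ∣ d then x d / d else 0) * (if k ∣ e then x e / e else 0)) =
      ∑ k ∈ Icc 1 M, ∑ e ∈ Icc 1 M, (k.totient : ℝ) *
        ((if k ∣ d then x d / d else 0) * (if k ∣ e then x e / e else 0)) :=
    fun d _ => sum_comm
  rw [sum_congr rfl h2, sum_comm]
  refine sum_congr rfl fun k _ => ?_
  rw [sum_filter, sq, sum_mul_sum, mul_sum]
  exact sum_congr rfl fun d _ => by rw [mul_sum]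

/-- The Selberg quadratic form of the truncated logarithm is `O(1 + log v)`. -/
lemma quadForm_le {v : ℝ} (hv : 0 ≤ v) {M : ℕ} (hM : ⌊v⌋₊ ≤ M) :
    ∑ d ∈ Icc 1 M, ∑ e ∈ Icc 1 M,
      (μ d * log⁺ (v / d)) * (μ e * log⁺ (v / e)) / (d.lcm e : ℕ) ≤ 100 * (1 + log⁺ v) := by
  rw [sum_sum_div_lcm M fun d => μ d * log⁺ (v / d)]
  have hinner : ∀ k ∈ Icc 1 M, (∑ d ∈ Icc 1 M with k ∣ d, μ d * log⁺ (v / d) / d) =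
      μ k / k * ∑ m ∈ Icc 1 (M / k),
        (if m.Coprime k then (μ m : ℝ) else 0) / m * log⁺ (v / k / m) := by
    intro k hk
    simp only [mem_Icc] at hk
    rw [sum_Icc_filter_dvd (by omega), mul_sum]
    refine sum_congr rfl fun m _ => ?_
    rw [moebius_mul_eq]
    push_cast
    rw [div_div v]
    ring
  have hterm : ∀ k ∈ Icc 1 M,
      (k.totient : ℝ) * (∑ d ∈ Icc 1 M with k ∣ d, μ d * log⁺ (v / d) / d) ^ 2 ≤
      if k ≤ ⌊v⌋₊ ∧ Squarefree k then 25 * (eulerProd k.primeFactors / k) else 0 := by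
    intro k hk
    have hk' := mem_Icc.1 hk
    rw [hinner k hk]
    have hk0 : (0 : ℝ) < k := by exact_mod_cast hk'.1
    split_ifs with hc
    · have h1 := abs_sum_coprime_moebius_log_le (k := k) (by omega) (t := v / k) (by positivity)
        (M := M / k) (by rw [Nat.floor_div_natCast]; exact Nat.div_le_div_right hM)
      set S := ∑ m ∈ Icc 1 (M / k),
        (if m.Coprime k then (μ m : ℝ) else 0) / m * log⁺ (v / k / m)
      have hμ : (μ k : ℝ) ^ 2 ≤ 1 := by
        have := ArithmeticFunction.abs_moebius_le_one (n := k)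
        rw [sq_le_one_iff_abs_le_one]; exact_mod_cast this
      have hS : S ^ 2 ≤ (5 * eulerProd k.primeFactors) ^ 2 := by
        rw [← sq_abs S]; exact pow_le_pow_left₀ (abs_nonneg _) h1 2
      have ht := totient_mul_eulerProd k
      calc (k.totient : ℝ) * (μ k / k * S) ^ 2 = (μ k : ℝ) ^ 2 * (k.totient / k ^ 2 * S ^ 2) := by
            field_simp
        _ ≤ 1 * (k.totient / k ^ 2 * (5 * eulerProd k.primeFactors) ^ 2) := by gcongr
        _ = 25 * ((k.totient * eulerProd k.primeFactors) * eulerProd k.primeFactors / k ^ 2) := by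
            ring
        _ = _ := by rw [ht]; field_simp
    · rw [not_and_or] at hc
      rcases hc with hc | hc
      · have hvk : v < k := (Nat.floor_lt hv).1 (not_le.1 hc)
        have : ∑ m ∈ Icc 1 (M / k),
            (if m.Coprime k then (μ m : ℝ) else 0) / m * log⁺ (v / k / m) = 0 := by
          refine sum_eq_zero fun m hm => ?_
          have hm1 : (1 : ℝ) ≤ m := by exact_mod_cast (mem_Icc.1 hm).1
          have : log⁺ (v / k / m) = 0 := by
            rw [posLog_eq_zero_iff, abs_of_nonneg (by positivity), div_div]
            exact div_le_one_of_le₀ (by nlinarith) (by positivity)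
          rw [this, mul_zero]
        simp [this]
      · simp [ArithmeticFunction.moebius_eq_zero_of_not_squarefree hc]
  refine (sum_le_sum hterm).trans ?_
  have hs : ∑ k ∈ Icc 1 M, (if k ≤ ⌊v⌋₊ ∧ Squarefree k then
      25 * (eulerProd k.primeFactors / k) else 0) =
      25 * ∑ k ∈ Icc 1 ⌊v⌋₊ with Squarefree k, eulerProd k.primeFactors / k := by
    rw [← sum_filter, mul_sum]
    refine sum_congr ?_ fun _ _ => rfl
    ext k
    simp only [mem_filter, mem_Icc]
    constructor
    · rintro ⟨h1, h2, h3⟩; exact ⟨⟨h1.1, h2⟩, h3⟩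
    · rintro ⟨h1, h3⟩; exact ⟨⟨h1.1, h1.2.trans hM⟩, h1.2, h3⟩
  rw [hs]
  have h1 := sum_eulerProd_div_le ⌊v⌋₊
  have h2 : log (⌊v⌋₊ : ℝ) ≤ log⁺ v := by
    rcases Nat.eq_zero_or_pos ⌊v⌋₊ with h | h
    · rw [h]; simpa using posLog_nonneg
    · exact (log_le_log (by exact_mod_cast h) (Nat.floor_le hv)).trans (le_max_right _ _)
  linarith

/-- The truncated sum `∑_{d ∣ n} μ(d) log⁺(z / d)`. -/
noncomputable def truncSum (z : ℝ) (n : ℕ) : ℝ := ∑ d ∈ n.divisors, μ d * log⁺ (z / d)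

lemma posLog_div_eq_zero {z : ℝ} (hz : 0 ≤ z) {d : ℕ} (h : z ≤ d) : log⁺ (z / d) = 0 := by
  rw [posLog_eq_zero_iff, abs_of_nonneg (by positivity)]
  exact div_le_one_of_le₀ h (by positivity)

lemma truncSum_eq {z : ℝ} (hz : 0 ≤ z) {n M : ℕ} (hn : n ≠ 0) (hM : ⌊z⌋₊ ≤ M) :
    truncSum z n = ∑ d ∈ Icc 1 M, if d ∣ n then μ d * log⁺ (z / d) else 0 := by
  have h0 : ∀ (s : Finset ℕ), ∑ d ∈ s, (if d ∣ n then μ d * log⁺ (z / d) else 0) =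
      ∑ d ∈ s with d ≤ ⌊z⌋₊, if d ∣ n then μ d * log⁺ (z / d) else 0 := by
    intro s
    rw [sum_filter]
    refine sum_congr rfl fun d _ => ?_
    split_ifs with h1 h2 h2 <;> try rfl
    rw [posLog_div_eq_zero hz ((Nat.floor_lt hz).1 (not_le.1 h2)).le, mul_zero]
  have h1 : truncSum z n = ∑ d ∈ Icc 1 n, if d ∣ n then μ d * log⁺ (z / d) else 0 := by
    rw [truncSum, ← sum_filter]
    refine sum_congr ?_ fun _ _ => rfl
    ext d
    simp only [Nat.mem_divisors, mem_filter, mem_Icc]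
    constructor
    · rintro ⟨h, _⟩
      exact ⟨⟨Nat.pos_of_dvd_of_pos h (by omega), Nat.le_of_dvd (by omega) h⟩, h⟩
    · rintro ⟨_, h⟩; exact ⟨h, hn⟩
  rw [h1, h0, h0 (Icc 1 M), ← sum_filter, ← sum_filter]
  refine sum_congr ?_ fun _ _ => rfl
  ext d
  simp only [mem_filter, mem_Icc]
  constructor
  · rintro ⟨⟨h1, h2⟩, h3⟩; exact ⟨⟨⟨h1.1, h2.trans hM⟩, h2⟩, h3⟩
  · rintro ⟨⟨h1, h2⟩, h3⟩; exact ⟨⟨⟨h1.1, Nat.le_of_dvd (by omega) h3⟩, h2⟩, h3⟩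

lemma truncSum_sq_eq {z : ℝ} (hz : 0 ≤ z) {n M : ℕ} (hn : n ≠ 0) (hM : ⌊z⌋₊ ≤ M) :
    truncSum z n ^ 2 = ∑ d ∈ Icc 1 M, ∑ e ∈ Icc 1 M,
      (μ d * log⁺ (z / d)) * (μ e * log⁺ (z / e)) * if d.lcm e ∣ n then 1 else 0 := by
  rw [truncSum_eq hz hn hM, sq, sum_mul_sum]
  refine sum_congr rfl fun d _ => sum_congr rfl fun e _ => ?_
  by_cases h1 : d ∣ n <;> by_cases h2 : e ∣ n <;> simp [h1, h2, Nat.lcm_dvd_iff]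

/-- Summation by parts against a sequence with partial sums bounded by `1`. -/
lemma abs_sum_mul_le (N : ℕ) (f c : ℕ → ℝ) (hc : ∀ n, |∑ i ∈ Icc 1 n, c i| ≤ 1) :
    |∑ n ∈ Icc 1 N, f n * c n| ≤ |f N| + ∑ n ∈ Ico 1 N, |f (n + 1) - f n| := by
  have h : ∑ n ∈ Icc 1 N, f n * c n = f N * ∑ i ∈ Icc 1 N, c i -
      ∑ n ∈ Ico 1 N, (f (n + 1) - f n) * ∑ i ∈ Icc 1 n, c i := by
    induction N with
    | zero => simp
    | succ N ih =>
      rw [sum_Icc_succ_top (by omega), ih, sum_Icc_succ_top (by omega)]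
      rcases Nat.eq_zero_or_pos N with rfl | hN
      · simp
      · rw [sum_Ico_succ_top (by omega)]
        ring
  rw [h]
  refine (abs_sub _ _).trans (add_le_add ?_ ?_)
  · rw [abs_mul]; exact mul_le_of_le_one_right (abs_nonneg _) (hc N)
  · refine (abs_sum_le_sum_abs _ _).trans (sum_le_sum fun n _ => ?_)
    rw [abs_mul]; exact mul_le_of_le_one_right (abs_nonneg _) (hc n)

lemma abs_sum_dvd_sub_le {D : ℕ} (hD : D ≠ 0) (n : ℕ) :
    |∑ i ∈ Icc 1 n, ((if D ∣ i then (1 : ℝ) else 0) - 1 / D)| ≤ 1 := by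
  rw [sum_sub_distrib, ← sum_filter, sum_Icc_filter_dvd hD]
  simp only [sum_const, Nat.card_Icc, nsmul_eq_mul, mul_one, Nat.add_sub_cancel]
  have h1 : ((n / D : ℕ) : ℝ) ≤ n / D := Nat.cast_div_le
  have h2 : (n : ℝ) / D < (n / D : ℕ) + 1 := by
    rw [← Nat.floor_div_eq_div (K := ℝ)]; exact Nat.lt_floor_add_one _
  rw [mul_one_div, abs_le]
  constructor <;> linarith

lemma sum_posLog_div_le {V : ℝ} (hV : 0 ≤ V) {M : ℕ} (hM : ⌊V⌋₊ ≤ M) :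
    ∑ d ∈ Icc 1 M, log⁺ (V / d) ≤ V := by
  rw [← sum_subset (Icc_subset_Icc_right hM) (f := fun d : ℕ => log⁺ (V / d))]
  · rcases lt_or_ge V 1 with h1 | h1
    · rw [Nat.floor_eq_zero.2 h1]; simpa using hV
    have hprod : ∀ n : ℕ, ∏ d ∈ Icc 1 n, (V / d) = V ^ n / n.factorial := by
      intro n
      induction n with
      | zero => simp
      | succ n ih =>
        rw [prod_Icc_succ_top (by omega), ih, Nat.factorial_succ]
        push_cast
        field_simp
        ring
    have e : ∑ d ∈ Icc 1 ⌊V⌋₊, log⁺ (V / d) = log (∏ d ∈ Icc 1 ⌊V⌋₊, (V / d)) := by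
      rw [log_prod]
      · refine sum_congr rfl fun d hd => posLog_eq_log ?_
        have hd := mem_Icc.1 hd
        have h2 : (0 : ℝ) < d := by exact_mod_cast hd.1
        rw [abs_of_nonneg (by positivity), one_le_div h2]
        exact (Nat.le_floor_iff hV).1 hd.2
      · intro d hd
        have hd := mem_Icc.1 hd
        have h2 : (0 : ℝ) < d := by exact_mod_cast hd.1
        positivity
    rw [e, hprod]
    have h3 := pow_div_factorial_le_exp V hV ⌊V⌋₊
    rw [← Real.log_exp V]
    conv_lhs => rw [Real.log_exp V]
    exact log_le_log (by positivity) h3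
  · intro d hd hd'
    simp only [mem_Icc, not_and, not_le] at hd hd'
    exact posLog_div_eq_zero hV ((Nat.floor_lt hV).1 (hd' hd.1)).le

lemma sum_Icc_inv_le {a : ℕ} (ha : 1 ≤ a) (N : ℕ) :
    ∑ n ∈ Icc a N, (n : ℝ)⁻¹ ≤ 1 + log⁺ (N / a) := by
  have ha' : (1 : ℝ) ≤ a := by exact_mod_cast ha
  rcases lt_or_ge N a with h | h
  · rw [Icc_eq_empty (by omega)]
    simp only [sum_empty]
    have : 0 ≤ log⁺ ((N : ℝ) / a) := posLog_nonneg
    linarith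
  · have key : ∑ n ∈ Icc a N, (n : ℝ)⁻¹ ≤ 1 + (log N - log a) := by
      induction N, h using Nat.le_induction with
      | base =>
        have := inv_le_one_of_one_le₀ ha'
        simpa using this
      | succ N hN ih =>
        rw [sum_Icc_succ_top (by omega)]
        have hN' : (1 : ℝ) ≤ N := by exact_mod_cast ha.trans hN
        have := one_sub_inv_le_log_of_pos (x := ((N : ℝ) + 1) / N) (by positivity)
        rw [log_div (by positivity) (by positivity)] at this
        have e : 1 - (((N : ℝ) + 1) / N)⁻¹ = ((N + 1 : ℕ) : ℝ)⁻¹ := by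
          push_cast; field_simp; ring
        rw [e] at this
        push_cast at *
        linarith
    rw [← log_div (by have : (a : ℝ) ≤ N := by exact_mod_cast h
                      linarith) (by positivity)] at key
    exact key.trans (by gcongr; exact le_max_right _ _)

lemma posLog_step {W : ℝ} (hW : 0 < W) {n d : ℕ} (hn : 1 ≤ n) (hd : 1 ≤ d) :
    log⁺ (n / W / d) ≤ log⁺ (((n + 1 : ℕ) : ℝ) / W / d) ∧
    log⁺ (((n + 1 : ℕ) : ℝ) / W / d) - log⁺ (n / W / d) ≤
      1 / n * if d ≤ ⌊((n + 1 : ℕ) : ℝ) / W⌋₊ then 1 else 0 := by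
  have hn' : (0 : ℝ) < n := by exact_mod_cast hn
  have hd' : (0 : ℝ) < d := by exact_mod_cast hd
  have hmono : log⁺ ((n : ℝ) / W / d) ≤ log⁺ (((n + 1 : ℕ) : ℝ) / W / d) := by
    apply monotoneOn_posLog (Set.mem_Ici.2 (by positivity)) (Set.mem_Ici.2 (by positivity))
    push_cast
    gcongr
    linarith
  refine ⟨hmono, ?_⟩
  split_ifs with h
  · have h1 : (d : ℝ) ≤ ((n + 1 : ℕ) : ℝ) / W := (Nat.le_floor_iff (by positivity)).1 h
    rw [posLog_eq_log (x := ((n + 1 : ℕ) : ℝ) / W / d)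
      (by rw [abs_of_nonneg (by positivity)]; exact (one_le_div hd').2 h1)]
    have h2 : log ((n : ℝ) / W / d) ≤ log⁺ ((n : ℝ) / W / d) := le_max_right _ _
    have h3 : log (((n + 1 : ℕ) : ℝ) / W / d) - log ((n : ℝ) / W / d) ≤ 1 / n := by
      rw [← log_div (by positivity) (by positivity)]
      have := log_le_sub_one_of_pos (x := ((n + 1 : ℕ) : ℝ) / W / d / ((n : ℝ) / W / d))
        (by positivity)
      have e : ((n + 1 : ℕ) : ℝ) / W / d / ((n : ℝ) / W / d) - 1 = 1 / n := by
        push_cast; field_simp; ring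
      linarith
    linarith
  · rw [posLog_div_eq_zero (z := ((n + 1 : ℕ) : ℝ) / W) (by positivity)
      ((Nat.floor_lt (by positivity)).1 (not_le.1 h)).le]
    have : 0 ≤ log⁺ ((n : ℝ) / W / d) := posLog_nonneg
    linarith

lemma abs_div_sub_div_le {a b a' b' i j n : ℝ} (hn : 0 < n) (ha : 0 ≤ a) (hb : 0 ≤ b)
    (haa : a ≤ a') (hbb : b ≤ b') (hi : a' - a ≤ 1 / n * i) (hj : b' - b ≤ 1 / n * j) :
    |a' * b' / (n + 1) - a * b / n| ≤ 1 / (n * (n + 1)) * (i * b' + a' * j + a' * b') := by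
  have hj0 : 0 ≤ 1 / n * j := by linarith
  have h1 : a' * b' - a * b ≤ 1 / n * (i * b' + a' * j) := by
    have e : a' * b' - a * b = (a' - a) * b' + a * (b' - b) := by ring
    have h2 : (a' - a) * b' ≤ 1 / n * i * b' := by gcongr; linarith
    have h3 : a * (b' - b) ≤ a' * (1 / n * j) := by
      apply mul_le_mul haa hj (by linarith) (by linarith)
    rw [e]; linarith
  have h0 : a * b ≤ a' * b' := mul_le_mul haa hbb hb (by linarith)
  have e1 : a' * b' / (n + 1) - a * b / n =
      (a' * b' - a * b) / (n + 1) - a * b * (1 / (n * (n + 1))) := by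
    field_simp; ring
  have e2 : 1 / (n * (n + 1)) * (i * b' + a' * j + a' * b') =
      1 / n * (i * b' + a' * j) / (n + 1) + a' * b' * (1 / (n * (n + 1))) := by
    field_simp
  have h4 : (a' * b' - a * b) / (n + 1) ≤ 1 / n * (i * b' + a' * j) / (n + 1) := by gcongr
  have h5 : a * b * (1 / (n * (n + 1))) ≤ a' * b' * (1 / (n * (n + 1))) := by gcongr
  have h6 : 0 ≤ (a' * b' - a * b) / (n + 1) := div_nonneg (by linarith) (by linarith)
  have h7 : 0 ≤ a * b * (1 / (n * (n + 1))) := by positivity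
  rw [e1, e2, abs_le]
  constructor <;> linarith

/-- The logarithmic mean square of `truncSum (n / W) n` over `n ≤ N`. -/
lemma sum_truncSum_sq_div_le {W : ℝ} (hW : 1 ≤ W) (N : ℕ) :
    ∑ n ∈ Icc 1 N, truncSum (n / W) n ^ 2 / n ≤
      100 * (1 + log⁺ (N / W)) ^ 2 + 7 * N / W ^ 2 := by
  rcases Nat.eq_zero_or_pos N with rfl | hN
  · simp
  have hW0 : 0 < W := by linarith
  have hfl : ∀ n ≤ N, ⌊(n : ℝ) / W⌋₊ ≤ N := by
    intro n hn
    refine le_trans ?_ hn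
    have h : (n : ℝ) / W ≤ n := div_le_self (by positivity) hW
    exact (Nat.floor_le_floor h).trans (Nat.floor_natCast n).le
  set a : ℕ → ℕ → ℝ := fun d n => log⁺ ((n : ℝ) / W / d) with ha
  have ha0 : ∀ d n, 0 ≤ a d n := fun _ _ => posLog_nonneg
  have hasum : ∀ n ≤ N, ∑ d ∈ Icc 1 N, a d n ≤ n / W := fun n hn =>
    sum_posLog_div_le (by positivity) (hfl n hn)
  -- split off the expected main term
  have hsplit : ∑ n ∈ Icc 1 N, truncSum (n / W) n ^ 2 / n =
      ∑ n ∈ Icc 1 N, (∑ d ∈ Icc 1 N, ∑ e ∈ Icc 1 N,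
        (μ d * a d n) * (μ e * a e n) / (d.lcm e : ℕ)) / n +
      ∑ d ∈ Icc 1 N, ∑ e ∈ Icc 1 N, (μ d * μ e) * ∑ n ∈ Icc 1 N,
        (a d n * a e n / n) * ((if d.lcm e ∣ n then (1 : ℝ) else 0) - 1 / (d.lcm e : ℕ)) := by
    have h1 : ∑ d ∈ Icc 1 N, ∑ e ∈ Icc 1 N, (μ d * μ e : ℝ) * ∑ n ∈ Icc 1 N,
        (a d n * a e n / n) * ((if d.lcm e ∣ n then (1 : ℝ) else 0) - 1 / (d.lcm e : ℕ)) =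
        ∑ n ∈ Icc 1 N, ∑ d ∈ Icc 1 N, ∑ e ∈ Icc 1 N, (μ d * μ e : ℝ) *
        ((a d n * a e n / n) * ((if d.lcm e ∣ n then (1 : ℝ) else 0) - 1 / (d.lcm e : ℕ))) := by
      simp_rw [mul_sum]
      rw [sum_comm]
      conv_rhs => rw [sum_comm]
      rw [sum_comm]
      exact sum_congr rfl fun d _ => sum_comm
    rw [h1, ← sum_add_distrib]
    refine sum_congr rfl fun n hn => ?_
    have hn := mem_Icc.1 hn
    rw [truncSum_sq_eq (by positivity) (by omega) (hfl n hn.2), sum_div, sum_div,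
      ← sum_add_distrib]
    refine sum_congr rfl fun d _ => ?_
    rw [sum_div, sum_div, ← sum_add_distrib]
    refine sum_congr rfl fun e _ => ?_
    simp only [ha]
    ring
  have hmain : ∑ n ∈ Icc 1 N, (∑ d ∈ Icc 1 N, ∑ e ∈ Icc 1 N,
        (μ d * a d n) * (μ e * a e n) / (d.lcm e : ℕ)) / n ≤
      100 * (1 + log⁺ (N / W)) ^ 2 := by
    have hp : 0 ≤ log⁺ ((N : ℝ) / W) := posLog_nonneg
    have h1 : ∀ n ∈ Icc 1 N, (∑ d ∈ Icc 1 N, ∑ e ∈ Icc 1 N,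
        (μ d * a d n) * (μ e * a e n) / (d.lcm e : ℕ)) / n ≤
        if ⌈W⌉₊ ≤ n then 100 * (1 + log⁺ (N / W)) * (n : ℝ)⁻¹ else 0 := by
      intro n hn
      have hn := mem_Icc.1 hn
      split_ifs with h
      · rw [div_eq_mul_inv]
        refine mul_le_mul_of_nonneg_right ?_ (by positivity)
        refine (quadForm_le (by positivity) (hfl n hn.2)).trans ?_
        gcongr
        exact hn.2
      · have h2 : (n : ℝ) < W := Nat.lt_ceil.1 (not_le.1 h)
        rw [sum_eq_zero, zero_div]
        intro d hd
        refine sum_eq_zero fun e _ => ?_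
        have : a d n = 0 := by
          refine posLog_div_eq_zero (by positivity) ?_
          have h3 : (1 : ℝ) ≤ d := by exact_mod_cast (mem_Icc.1 hd).1
          exact (div_le_one_of_le₀ h2.le hW0.le).trans h3
        simp [this]
    refine (sum_le_sum h1).trans ?_
    rw [← sum_filter, ← mul_sum]
    have h2 : {n ∈ Icc 1 N | ⌈W⌉₊ ≤ n} = Icc ⌈W⌉₊ N := by
      have : 1 ≤ ⌈W⌉₊ := Nat.one_le_ceil_iff.2 hW0
      ext n; simp only [mem_filter, mem_Icc]; omega
    rw [h2]
    have hc : W ≤ ⌈W⌉₊ := Nat.le_ceil W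
    have h3 := sum_Icc_inv_le (Nat.one_le_ceil_iff.2 hW0) N
    have h4 : log⁺ ((N : ℝ) / ⌈W⌉₊) ≤ log⁺ (N / W) := by
      apply monotoneOn_posLog (Set.mem_Ici.2 (by positivity)) (Set.mem_Ici.2 (by positivity))
      gcongr
    calc _ ≤ 100 * (1 + log⁺ (N / W)) * (1 + log⁺ (N / W)) := by gcongr; linarith
      _ = _ := by ring
  -- the error term
  have herr : ∑ d ∈ Icc 1 N, ∑ e ∈ Icc 1 N, (μ d * μ e : ℝ) * ∑ n ∈ Icc 1 N,
        (a d n * a e n / n) * ((if d.lcm e ∣ n then (1 : ℝ) else 0) - 1 / (d.lcm e : ℕ)) ≤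
      7 * N / W ^ 2 := by
    set ι : ℕ → ℕ → ℝ := fun d n => if d ≤ ⌊((n + 1 : ℕ) : ℝ) / W⌋₊ then 1 else 0 with hι
    have hμ : ∀ d : ℕ, |(μ d : ℝ)| ≤ 1 := fun d => by
      exact_mod_cast ArithmeticFunction.abs_moebius_le_one
    have h1 : ∀ d ∈ Icc 1 N, ∀ e ∈ Icc 1 N, (μ d * μ e : ℝ) * ∑ n ∈ Icc 1 N,
        (a d n * a e n / n) * ((if d.lcm e ∣ n then (1 : ℝ) else 0) - 1 / (d.lcm e : ℕ)) ≤
        a d N * a e N / N + ∑ n ∈ Ico 1 N, 1 / ((n : ℝ) * (n + 1)) *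
          (ι d n * a e (n + 1) + a d (n + 1) * ι e n + a d (n + 1) * a e (n + 1)) := by
      intro d hd e he
      have hd := mem_Icc.1 hd
      have he := mem_Icc.1 he
      refine (le_abs_self _).trans ?_
      rw [abs_mul, abs_mul]
      have h2 := abs_sum_mul_le N (fun n => a d n * a e n / n)
        (fun n => (if d.lcm e ∣ n then (1 : ℝ) else 0) - 1 / (d.lcm e : ℕ))
        (abs_sum_dvd_sub_le (Nat.lcm_ne_zero (by omega) (by omega)))
      refine (mul_le_of_le_one_left (abs_nonneg _)
        (mul_le_one₀ (hμ d) (abs_nonneg _) (hμ e))).trans (h2.trans ?_)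
      refine add_le_add ?_ (sum_le_sum fun n hn => ?_)
      · rw [abs_of_nonneg]
        have := ha0 d N; have := ha0 e N; positivity
      · have hn := mem_Ico.1 hn
        have hn' : (0 : ℝ) < n := by exact_mod_cast hn.1
        obtain ⟨p1, p2⟩ := posLog_step hW0 hn.1 hd.1
        obtain ⟨q1, q2⟩ := posLog_step hW0 hn.1 he.1
        have := abs_div_sub_div_le hn' (ha0 d n) (ha0 e n) p1 q1 p2 q2
        push_cast at this ⊢
        simp only [ha, hι]
        push_cast
        exact this
    refine (sum_le_sum fun d hd => sum_le_sum fun e he => h1 d hd e he).trans ?_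
    simp_rw [sum_add_distrib]
    have hN' : (0 : ℝ) < N := by exact_mod_cast hN
    have t1 : ∑ d ∈ Icc 1 N, ∑ e ∈ Icc 1 N, a d N * a e N / N ≤ N / W ^ 2 := by
      have e1 : ∑ d ∈ Icc 1 N, ∑ e ∈ Icc 1 N, a d N * a e N / N =
          (∑ d ∈ Icc 1 N, a d N) ^ 2 / N := by
        rw [sq, sum_mul_sum, sum_div]
        exact sum_congr rfl fun d _ => by rw [sum_div]
      have h3 : (∑ d ∈ Icc 1 N, a d N) ^ 2 ≤ (N / W) ^ 2 :=
        pow_le_pow_left₀ (sum_nonneg fun _ _ => ha0 _ _) (hasum N le_rfl) 2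
      rw [e1, div_le_iff₀ hN']
      refine h3.trans (le_of_eq ?_)
      field_simp
    have t2 : ∑ d ∈ Icc 1 N, ∑ e ∈ Icc 1 N, ∑ n ∈ Ico 1 N, 1 / ((n : ℝ) * (n + 1)) *
          (ι d n * a e (n + 1) + a d (n + 1) * ι e n + a d (n + 1) * a e (n + 1)) ≤
        6 * N / W ^ 2 := by
      have e1 : ∑ d ∈ Icc 1 N, ∑ e ∈ Icc 1 N, ∑ n ∈ Ico 1 N, 1 / ((n : ℝ) * (n + 1)) *
          (ι d n * a e (n + 1) + a d (n + 1) * ι e n + a d (n + 1) * a e (n + 1)) =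
          ∑ n ∈ Ico 1 N, 1 / ((n : ℝ) * (n + 1)) *
          (2 * ((∑ d ∈ Icc 1 N, ι d n) * ∑ d ∈ Icc 1 N, a d (n + 1)) +
            (∑ d ∈ Icc 1 N, a d (n + 1)) ^ 2) := by
        rw [sum_congr rfl fun d _ => sum_comm, sum_comm]
        refine sum_congr rfl fun n _ => ?_
        simp_rw [← mul_sum]
        congr 1
        simp_rw [sum_add_distrib]
        simp_rw [← mul_sum, ← sum_mul]
        ring
      rw [e1]
      calc _ ≤ ∑ n ∈ Ico 1 N, 6 / W ^ 2 := by
            refine sum_le_sum fun n hn => ?_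
            have hn := mem_Ico.1 hn
            have hn' : (1 : ℝ) ≤ n := by exact_mod_cast hn.1
            have i1 : ∑ d ∈ Icc 1 N, ι d n ≤ ((n + 1 : ℕ) : ℝ) / W := by
              simp only [hι]
              rw [← sum_filter, sum_const, nsmul_eq_mul, mul_one]
              refine le_trans ?_ (Nat.floor_le (by positivity))
              have : {d ∈ Icc 1 N | d ≤ ⌊((n + 1 : ℕ) : ℝ) / W⌋₊} ⊆
                  Icc 1 ⌊((n + 1 : ℕ) : ℝ) / W⌋₊ := by
                intro d; simp only [mem_filter, mem_Icc]; omega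
              have := card_le_card this
              rw [Nat.card_Icc, Nat.add_sub_cancel] at this
              exact_mod_cast this
            have i2 := hasum (n + 1) (by omega)
            have i3 : 0 ≤ ∑ d ∈ Icc 1 N, a d (n + 1) := sum_nonneg fun _ _ => ha0 _ _
            calc _ ≤ 1 / ((n : ℝ) * (n + 1)) * (2 * ((((n + 1 : ℕ) : ℝ) / W) *
                  (((n + 1 : ℕ) : ℝ) / W)) + (((n + 1 : ℕ) : ℝ) / W) ^ 2) := by gcongr
              _ = 3 * ((n + 1) / n) / W ^ 2 := by push_cast; field_simp; ring
              _ ≤ 3 * 2 / W ^ 2 := by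
                gcongr
                rw [div_le_iff₀ (by linarith)]; linarith
              _ = 6 / W ^ 2 := by norm_num
        _ ≤ 6 * N / W ^ 2 := by
            rw [sum_const, Nat.card_Ico, nsmul_eq_mul, mul_div_assoc', mul_comm]
            gcongr
            omega
    calc _ ≤ N / W ^ 2 + 6 * N / W ^ 2 := add_le_add t1 t2
      _ = _ := by ring
  rw [hsplit]
  exact add_le_add hmain herr

lemma hasSum_factoredNumbers_dvd {s : Finset ℕ} {D : ℕ} (hD : D ∈ Nat.factoredNumbers s) :
    HasSum (fun m : Nat.factoredNumbers s => if D ∣ m then ((m : ℕ) : ℝ)⁻¹ else 0)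
      (eulerProd s / D) := by
  have hD0 : D ≠ 0 := Nat.ne_zero_of_mem_factoredNumbers hD
  let g : Nat.factoredNumbers s → Nat.factoredNumbers s :=
    fun m => ⟨D * m, Nat.mul_mem_factoredNumbers hD m.2⟩
  have hg : Function.Injective g := by
    intro a b h
    have h1 : D * (a : ℕ) = D * b := congrArg Subtype.val h
    exact Subtype.ext (Nat.eq_of_mul_eq_mul_left (Nat.pos_of_ne_zero hD0) h1)
  rw [← hg.hasSum_iff]
  · have h := (hasSum_factoredNumbers s).div_const (D : ℝ)
    refine h.congr_fun fun m => ?_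
    simp [g, div_eq_mul_inv, mul_comm]
  · rintro ⟨m, hm⟩ hr
    rw [if_neg]
    rintro ⟨k, rfl⟩
    exact hr ⟨⟨k, Nat.mem_factoredNumbers_of_dvd hm (Dvd.intro_left D rfl)⟩, rfl⟩

/-- Bound for the logarithmic mean square of `truncSum z n` with `z` fixed. -/
lemma sum_truncSum_const_sq_div_le {z : ℝ} {N : ℕ} (hz : 0 ≤ z) (hN : ⌊z⌋₊ ≤ N) :
    ∑ n ∈ Icc 1 N, truncSum z n ^ 2 / n ≤
      eulerProd (range (N + 1)) * (100 * (1 + log⁺ z)) := by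
  classical
  set s := range (N + 1) with hs
  have hmem : ∀ n ∈ Icc 1 N, n ∈ Nat.factoredNumbers s := by
    intro n hn
    have hn := mem_Icc.1 hn
    refine Nat.mem_factoredNumbers_of_primeFactors_subset (by omega) fun p hp => ?_
    have := Nat.le_of_mem_primeFactors hp
    exact mem_range.2 (by omega)
  have h : HasSum (fun m : Nat.factoredNumbers s => truncSum z m ^ 2 / (m : ℕ))
      (∑ d ∈ Icc 1 N, ∑ e ∈ Icc 1 N, (μ d * log⁺ (z / d)) * (μ e * log⁺ (z / e)) *
        (eulerProd s / (d.lcm e : ℕ))) := by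
    have h1 : HasSum (fun m : Nat.factoredNumbers s => ∑ d ∈ Icc 1 N, ∑ e ∈ Icc 1 N,
        (μ d * log⁺ (z / d)) * (μ e * log⁺ (z / e)) *
          (if d.lcm e ∣ m then ((m : ℕ) : ℝ)⁻¹ else 0)) _ :=
      hasSum_sum fun d hd => hasSum_sum fun e he => (hasSum_factoredNumbers_dvd
        (Nat.mem_factoredNumbers_of_dvd (Nat.mul_mem_factoredNumbers (hmem d hd) (hmem e he))
          (Nat.lcm_dvd_mul d e))).mul_left _
    refine h1.congr_fun fun m => ?_
    rw [truncSum_sq_eq hz (Nat.ne_zero_of_mem_factoredNumbers m.2) hN, sum_div]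
    refine sum_congr rfl fun d _ => ?_
    rw [sum_div]
    refine sum_congr rfl fun e _ => ?_
    split_ifs <;> simp [div_eq_mul_inv]
  have h2 := sum_le_hasSum ((Icc 1 N).subtype (· ∈ Nat.factoredNumbers s))
    (fun _ _ => by positivity) h
  rw [sum_subtype_of_mem (fun n : ℕ => truncSum z n ^ 2 / (n : ℝ)) hmem] at h2
  refine h2.trans ?_
  have hP := one_le_eulerProd s
  calc _ = eulerProd s * ∑ d ∈ Icc 1 N, ∑ e ∈ Icc 1 N,
        (μ d * log⁺ (z / d)) * (μ e * log⁺ (z / e)) / (d.lcm e : ℕ) := by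
        simp_rw [mul_sum]
        refine sum_congr rfl fun d _ => sum_congr rfl fun e _ => by ring
    _ ≤ _ := by gcongr; exact quadForm_le hz hN

lemma sum_vonMangoldt_div_le (N : ℕ) :
    ∑ d ∈ Icc 1 N, ArithmeticFunction.vonMangoldt d / d ≤ 2 * log N := by
  rcases Nat.eq_zero_or_pos N with rfl | hN
  · simp
  have h0 : (0 : ℝ) < N := by exact_mod_cast hN
  have h1 : ∑ n ∈ Icc 1 N, log n ≤ N * log N := by
    calc _ ≤ ∑ n ∈ Icc 1 N, log N := by
          refine sum_le_sum fun n hn => ?_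
          have hn := mem_Icc.1 hn
          have : (0 : ℝ) < n := by exact_mod_cast hn.1
          exact log_le_log this (by exact_mod_cast hn.2)
      _ = _ := by simp
  have h2 := sum_mul_sum_divisors N (fun d => ArithmeticFunction.vonMangoldt d) (fun _ => 1)
  simp_rw [ArithmeticFunction.vonMangoldt_sum, one_mul] at h2
  rw [h2] at h1
  have h3 : N / 2 * ∑ d ∈ Icc 1 N, ArithmeticFunction.vonMangoldt d / d ≤
      ∑ d ∈ Icc 1 N, ArithmeticFunction.vonMangoldt d *
        ∑ n ∈ Icc 1 N with d ∣ n, (1 : ℝ) := by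
    rw [mul_sum]
    refine sum_le_sum fun d hd => ?_
    have hd := mem_Icc.1 hd
    have hd0 : (0 : ℝ) < d := by exact_mod_cast hd.1
    rw [sum_Icc_filter_dvd (by omega)]
    simp only [sum_const, Nat.card_Icc, nsmul_eq_mul, mul_one, Nat.add_sub_cancel]
    have h4 : (N : ℝ) / d ≤ 2 * (N / d : ℕ) := by
      have h5 : (N : ℝ) / d < (N / d : ℕ) + 1 := by
        rw [← Nat.floor_div_eq_div (K := ℝ)]; exact Nat.lt_floor_add_one _
      have h6 : (1 : ℝ) ≤ (N / d : ℕ) := by exact_mod_cast Nat.div_pos hd.2 hd.1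
      linarith
    have h7 : 0 ≤ ArithmeticFunction.vonMangoldt d := ArithmeticFunction.vonMangoldt_nonneg
    calc _ = ArithmeticFunction.vonMangoldt d * (N / d / 2) := by ring
      _ ≤ _ := by gcongr; linarith
  have h8 := h3.trans h1
  have : N / 2 * ∑ d ∈ Icc 1 N, ArithmeticFunction.vonMangoldt d / d ≤
      N / 2 * (2 * log N) := by linarith
  exact le_of_mul_le_mul_left this (by positivity)

lemma sum_rpow_le {σ : ℝ} (hσ : 0 < σ) (N : ℕ) :
    ∑ n ∈ Icc 1 N, (n : ℝ) ^ (-(1 + σ)) ≤ 1 + 1 / σ := by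
  have h : ∀ N : ℕ, ∑ n ∈ Icc 1 (N + 1), (n : ℝ) ^ (-(1 + σ)) ≤
      1 + (1 - ((N + 1 : ℕ) : ℝ) ^ (-σ)) / σ := by
    intro N
    induction N with
    | zero => simp
    | succ N ih =>
      rw [sum_Icc_succ_top (by omega)]
      have h1 : ((N + 1 + 1 : ℕ) : ℝ) ^ (-(1 + σ)) ≤
          (((N + 1 : ℕ) : ℝ) ^ (-σ) - ((N + 1 + 1 : ℕ) : ℝ) ^ (-σ)) / σ := by
        set b : ℝ := ((N + 1 + 1 : ℕ) : ℝ) with hb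
        have hb1 : 1 < b := by rw [hb]; push_cast; linarith [(N.cast_nonneg : (0 : ℝ) ≤ N)]
        have hb0 : 0 < b := by linarith
        have ha : ((N + 1 : ℕ) : ℝ) = b * (1 - 1 / b) := by
          rw [mul_sub, mul_one_div_cancel hb0.ne', hb]; push_cast; ring
        have hc : 0 < 1 - 1 / b := by
          have := (div_lt_one hb0).2 hb1
          linarith
        rw [ha, mul_rpow hb0.le hc.le, le_div_iff₀ hσ]
        have h2 : 1 + σ / b ≤ (1 - 1 / b) ^ (-σ) := by
          rw [rpow_def_of_pos hc]
          refine le_trans ?_ (add_one_le_exp _)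
          have h3 := log_le_sub_one_of_pos hc
          have h4 : σ * log (1 - 1 / b) ≤ σ * (-(1 / b)) := by gcongr; linarith
          have : σ * (-(1 / b)) = -(σ / b) := by ring
          linarith
        have h5 : b ^ (-(1 + σ)) = b ^ (-σ) * b⁻¹ := by
          rw [← rpow_neg_one, ← rpow_add hb0]; congr 1; ring
        have h6 : 0 < b ^ (-σ) := rpow_pos_of_pos hb0 _
        have h7 : b ^ (-σ) * (1 + σ / b) ≤ b ^ (-σ) * (1 - 1 / b) ^ (-σ) := by gcongr
        have h8 : b ^ (-σ) * (1 + σ / b) = b ^ (-σ) * b⁻¹ * σ + b ^ (-σ) := by ring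
        rw [h5]; linarith
      have h9 : (1 - ((N + 1 + 1 : ℕ) : ℝ) ^ (-σ)) / σ = (1 - ((N + 1 : ℕ) : ℝ) ^ (-σ)) / σ +
        (((N + 1 : ℕ) : ℝ) ^ (-σ) - ((N + 1 + 1 : ℕ) : ℝ) ^ (-σ)) / σ := by ring
      linarith
  rcases N with _ | N
  · simp; positivity
  · refine (h N).trans ?_
    have : 0 ≤ ((N + 1 : ℕ) : ℝ) ^ (-σ) := by positivity
    gcongr; linarith

/-- `n ↦ n ^ (-a)` as a completely multiplicative function. -/
noncomputable def rpowHom (a : ℝ) : ℕ →* ℝ where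
  toFun n := (n : ℝ) ^ (-a)
  map_one' := by simp
  map_mul' m n := by push_cast; rw [mul_rpow (by positivity) (by positivity)]

lemma prod_one_sub_rpow_inv_le {σ : ℝ} (hσ : 0 < σ) (s : Finset ℕ) :
    ∏ p ∈ s with p.Prime, (1 - (p : ℝ) ^ (-(1 + σ)))⁻¹ ≤ 1 + 1 / σ := by
  have h := (EulerProduct.summable_and_hasSum_factoredNumbers_prod_filter_prime_geometric
    (f := rpowHom (1 + σ)) (by
      intro p hp
      have hp1 : (1 : ℝ) < p := by exact_mod_cast hp.one_lt
      change ‖(p : ℝ) ^ (-(1 + σ))‖ < 1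
      rw [norm_of_nonneg (by positivity)]
      exact rpow_lt_one_of_one_lt_of_neg hp1 (by linarith)) s).2
  refine hasSum_le_of_sum_le h fun t => ?_
  change ∑ m ∈ t, ((m : ℕ) : ℝ) ^ (-(1 + σ)) ≤ _
  refine (sum_map t (Function.Embedding.subtype _)
    (fun n : ℕ => (n : ℝ) ^ (-(1 + σ)))).symm.trans_le ?_
  refine le_trans ?_ (sum_rpow_le hσ ((t.map (Function.Embedding.subtype _)).sup id))
  refine sum_le_sum_of_subset_of_nonneg ?_ fun _ _ _ => by positivity
  intro n hn
  obtain ⟨m, _, rfl⟩ := mem_map.1 hn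
  exact mem_Icc.2 ⟨Nat.pos_of_ne_zero (Nat.ne_zero_of_mem_factoredNumbers m.2),
    le_sup (f := id) hn⟩

/-- An upper bound of Mertens type for the product over the primes up to `N`. -/
lemma eulerProd_range_le {N : ℕ} (hN : 2 ≤ N) :
    eulerProd (range (N + 1)) ≤ exp 4 * (1 + log N) := by
  have hN1 : (1 : ℝ) < N := by exact_mod_cast hN
  have hl : 0 < log N := log_pos hN1
  set σ := (log N)⁻¹ with hσ
  have hσ0 : 0 < σ := inv_pos.2 hl
  have h1 : eulerProd (range (N + 1)) ≤ ∏ p ∈ range (N + 1) with p.Prime,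
      ((1 - (p : ℝ) ^ (-(1 + σ)))⁻¹ * exp (σ * (log p / (p - 1)))) := by
    refine prod_le_prod ?_ ?_
    · intro p hp
      have hp1 : (1 : ℝ) < p := by exact_mod_cast (mem_filter.1 hp).2.one_lt
      have := inv_lt_one_of_one_lt₀ hp1
      exact inv_nonneg.2 (by linarith)
    · intro p hp
      have hp1 : (1 : ℝ) < p := by exact_mod_cast (mem_filter.1 hp).2.one_lt
      have hp0 : (0 : ℝ) < p := by linarith
      have ha : 0 < 1 - (p : ℝ)⁻¹ := by
        have := inv_lt_one_of_one_lt₀ hp1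
        linarith
      have hb : 0 < 1 - (p : ℝ) ^ (-(1 + σ)) := by
        have := rpow_lt_one_of_one_lt_of_neg hp1 (show -(1 + σ) < 0 by linarith)
        linarith
      rw [inv_mul_eq_div, le_div_iff₀ hb, inv_mul_le_iff₀ ha]
      have e1 : (p : ℝ) ^ (-(1 + σ)) = (p : ℝ)⁻¹ * (p : ℝ) ^ (-σ) := by
        rw [← rpow_neg_one, ← rpow_add hp0]; congr 1; ring
      have h2 : 1 - σ * log p ≤ (p : ℝ) ^ (-σ) := by
        rw [rpow_def_of_pos hp0]
        have := add_one_le_exp (log p * -σ)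
        linarith
      have h3 := add_one_le_exp (σ * (log p / (p - 1)))
      calc 1 - (p : ℝ) ^ (-(1 + σ)) ≤ 1 - (p : ℝ)⁻¹ * (1 - σ * log p) := by
            rw [e1]; gcongr
        _ = (1 - (p : ℝ)⁻¹) * (σ * (log p / (p - 1)) + 1) := by
            have : (p : ℝ) - 1 ≠ 0 := by linarith
            field_simp
            ring
        _ ≤ _ := by gcongr
  refine h1.trans ?_
  rw [prod_mul_distrib, ← exp_sum, mul_comm]
  have h2 := prod_one_sub_rpow_inv_le hσ0 (range (N + 1))
  have h3 : ∑ p ∈ range (N + 1) with p.Prime, log p / (p - 1 : ℝ) ≤ 4 * log N := by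
    calc ∑ p ∈ range (N + 1) with p.Prime, log p / (p - 1 : ℝ)
        ≤ ∑ p ∈ range (N + 1) with p.Prime, 2 * (ArithmeticFunction.vonMangoldt p / p) := by
          refine sum_le_sum fun p hp => ?_
          have hpp := (mem_filter.1 hp).2
          have hp2 : (2 : ℝ) ≤ p := by exact_mod_cast hpp.two_le
          rw [ArithmeticFunction.vonMangoldt_apply_prime hpp, div_le_iff₀ (by linarith)]
          have : 0 ≤ log p := log_nonneg (by linarith)
          have h4 : 2 * (log p / p) * (p - 1) = log p * (2 * (p - 1) / p) := by ring
          rw [h4]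
          refine le_mul_of_one_le_right this ?_
          rw [le_div_iff₀ (by linarith)]; linarith
      _ ≤ ∑ p ∈ Icc 1 N, 2 * (ArithmeticFunction.vonMangoldt p / p) := by
          refine sum_le_sum_of_subset_of_nonneg ?_ ?_
          · intro p hp
            have hp := mem_filter.1 hp
            have := mem_range.1 hp.1
            exact mem_Icc.2 ⟨hp.2.one_lt.le, by omega⟩
          · intro p _ _
            have : 0 ≤ ArithmeticFunction.vonMangoldt p := ArithmeticFunction.vonMangoldt_nonneg
            positivity
      _ ≤ 4 * log N := by
          rw [← mul_sum]; linarith [sum_vonMangoldt_div_le N]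
  rw [← mul_sum]
  have h4 : σ * ∑ p ∈ range (N + 1) with p.Prime, log p / (p - 1 : ℝ) ≤ 4 := by
    calc _ ≤ σ * (4 * log N) := by gcongr
      _ = 4 := by rw [hσ]; field_simp
  have h5 : 1 + 1 / σ = 1 + log N := by rw [hσ]; simp
  rw [h5] at h2
  calc _ ≤ exp 4 * ∏ p ∈ range (N + 1) with p.Prime, (1 - (p : ℝ) ^ (-(1 + σ)))⁻¹ := by
        refine mul_le_mul_of_nonneg_right (exp_le_exp.2 h4) (prod_nonneg fun p hp => ?_)
        have hp1 : (1 : ℝ) < p := by exact_mod_cast (mem_filter.1 hp).2.one_lt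
        have := rpow_lt_one_of_one_lt_of_neg hp1 (show -(1 + σ) < 0 by linarith)
        exact inv_nonneg.2 (by linarith)
    _ ≤ _ := by gcongr

/-- The complementary truncated sum `∑_{d ∣ n} μ(d) log⁺(d / z)`. -/
noncomputable def tailSum (z : ℝ) (n : ℕ) : ℝ := ∑ d ∈ n.divisors, μ d * log⁺ (d / z)

lemma truncSum_sub_truncSum {y w : ℝ} (hy : 0 < y) (hw : 0 < w) {n : ℕ} (hn : n ≠ 1) :
    truncSum y n - truncSum w n = tailSum y n - tailSum w n := by
  have h : ∀ z : ℝ, 0 < z → truncSum z n - tailSum z n = -∑ d ∈ n.divisors, μ d * log d := by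
    intro z hz
    have h1 : ∑ d ∈ n.divisors, (μ d : ℝ) * log z = 0 := by
      rw [← sum_mul, sum_divisors_moebius, if_neg hn, zero_mul]
    rw [truncSum, tailSum, ← sum_sub_distrib, ← zero_sub, ← h1, ← sum_sub_distrib]
    refine sum_congr rfl fun d hd => ?_
    have hd0 : (d : ℝ) ≠ 0 := by exact_mod_cast (Nat.pos_of_mem_divisors hd).ne'
    rw [← mul_sub, ← mul_sub, ← inv_div z, posLog_sub_posLog_inv, log_div hz.ne' hd0]
  have h1 := h y hy
  have h2 := h w hw
  linarith

lemma tailSum_eq_of_squarefree {z : ℝ} {m : ℕ} (hm : Squarefree m) :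
    tailSum z m = μ m * truncSum (m / z) m := by
  rw [tailSum, truncSum, ← Nat.sum_div_divisors, mul_sum]
  refine sum_congr rfl fun d hd => ?_
  obtain ⟨e, rfl⟩ := Nat.dvd_of_mem_divisors hd
  have hd0 : d ≠ 0 := left_ne_zero_of_mul hm.ne_zero
  have hd1 : (d : ℝ) ≠ 0 := by exact_mod_cast hd0
  have hc : d.Coprime e := Nat.coprime_of_squarefree_mul hm
  rw [Nat.mul_div_cancel_left e (Nat.pos_of_ne_zero hd0), moebius_mul_eq, if_pos hc.symm]
  have hs : (μ d : ℝ) ^ 2 = 1 := by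
    exact_mod_cast ArithmeticFunction.moebius_sq_eq_one_of_squarefree hm.of_mul_left
  have e1 : ((d * e : ℕ) : ℝ) / z / d = e / z := by
    push_cast; field_simp
  rw [e1]
  linear_combination (-(μ e : ℝ) * log⁺ (e / z)) * hs

lemma tailSum_sq_mul_eq {z : ℝ} {s g m : ℕ} (hs : s ≠ 0) (hg : g ∣ s) (hm : m.Coprime s) :
    tailSum z (s ^ 2 * g * m) = ∑ j ∈ s.divisors, μ j * tailSum (z / j) m := by
  have hg0 : g ≠ 0 := fun h => hs (by simpa [h] using hg)
  have hA : s ^ 2 * g ∣ s ^ 3 := by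
    rw [pow_succ s 2]; exact mul_dvd_mul_left _ hg
  have hc : (s ^ 2 * g).Coprime m :=
    (Nat.Coprime.of_dvd_left hA (Nat.Coprime.pow_left 3 hm.symm))
  have hsub : s.divisors ⊆ (s ^ 2 * g).divisors :=
    Nat.divisors_subset_of_dvd (by positivity) ((dvd_pow_self s two_ne_zero).mul_right g)
  rw [tailSum, Nat.divisors_mul, Finset.mul_def, sum_image hc.mul_injOn_divisors, sum_product]
  symm
  refine (sum_subset hsub fun j hj hjs => ?_).trans (sum_congr rfl fun j hj => ?_)
  · rw [ArithmeticFunction.moebius_eq_zero_of_not_squarefree]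
    · simp
    · intro hsq
      exact hjs (Nat.mem_divisors.2 ⟨(hsq.dvd_pow_iff_dvd three_ne_zero).1
        ((Nat.dvd_of_mem_divisors hj).trans hA), hs⟩)
  · rw [tailSum, mul_sum]
    refine sum_congr rfl fun e he => ?_
    have hje : e.Coprime j := (Nat.Coprime.of_dvd_left (Nat.dvd_of_mem_divisors hj)
      (Nat.Coprime.of_dvd_right (Nat.dvd_of_mem_divisors he) hc)).symm
    rw [moebius_mul_eq, if_pos hje, mul_assoc, div_div_eq_mul_div]
    push_cast
    rw [mul_comm (e : ℝ) j]

lemma tailSum_sq_mul_sq_le {z : ℝ} {s g m : ℕ} (hs : s ≠ 0) (hg : g ∣ s) (hm : m.Coprime s)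
    (hm' : Squarefree m) :
    tailSum z (s ^ 2 * g * m) ^ 2 ≤
      #s.divisors * ∑ j ∈ s.divisors, truncSum (m / (z / j)) m ^ 2 := by
  have hμ : ∀ d : ℕ, (μ d : ℝ) ^ 2 ≤ 1 := fun d => by
    rw [sq_le_one_iff_abs_le_one]
    exact_mod_cast ArithmeticFunction.abs_moebius_le_one
  rw [tailSum_sq_mul_eq hs hg hm]
  refine sq_sum_le_card_mul_sum_sq.trans ?_
  refine mul_le_mul_of_nonneg_left (sum_le_sum fun j _ => ?_) (by positivity)
  rw [tailSum_eq_of_squarefree hm', mul_pow, mul_pow]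
  calc _ ≤ 1 * (1 * truncSum (m / (z / j)) m ^ 2) := by gcongr <;> exact hμ _
    _ = _ := by ring

lemma exists_sq_mul_mul (n : ℕ) :
    ∃ s g m : ℕ, n = s ^ 2 * g * m ∧ g ∣ s ∧ m.Coprime s ∧ Squarefree m := by
  obtain ⟨t, s, h, ht⟩ := Nat.sq_mul_squarefree n
  obtain ⟨m, hm⟩ := Nat.gcd_dvd_left t s
  have hsq : Squarefree (t.gcd s * m) := hm ▸ ht
  refine ⟨s, t.gcd s, m, ?_, Nat.gcd_dvd_right t s, ?_, hsq.of_mul_right⟩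
  · rw [← h, mul_assoc, ← hm]
  · have h1 : m.gcd s ∣ t.gcd s :=
      Nat.dvd_gcd (hm ▸ (Nat.gcd_dvd_left m s).mul_left _) (Nat.gcd_dvd_right m s)
    exact Nat.isUnit_iff.1 (hsq _ (mul_dvd_mul h1 (Nat.gcd_dvd_left m s)))

/-- Summation over all `n ≤ N` majorised by summation over the factorisations
`n = s ^ 2 * g * m` with `g ∣ s`. -/
lemma sum_le_sum_sq_mul_mul (N : ℕ) (f : ℕ → ℝ) (h : ℕ → ℕ → ℕ → ℝ)
    (h0 : ∀ s g m, 0 ≤ h s g m)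
    (hf : ∀ s g m, s ≠ 0 → g ∣ s → m.Coprime s → Squarefree m → f (s ^ 2 * g * m) ≤ h s g m) :
    ∑ n ∈ Icc 1 N, f n ≤
      ∑ s ∈ Icc 1 N, ∑ g ∈ s.divisors, ∑ m ∈ Icc 1 (N / (s ^ 2 * g)), h s g m := by
  classical
  choose a b c ht using exists_sq_mul_mul
  set T := (Icc 1 N).sigma fun s => s.divisors.sigma fun g => Icc 1 (N / (s ^ 2 * g))
  have hT : ∑ s ∈ Icc 1 N, ∑ g ∈ s.divisors, ∑ m ∈ Icc 1 (N / (s ^ 2 * g)), h s g m =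
      ∑ q ∈ T, h q.1 q.2.1 q.2.2 := by
    rw [sum_sigma]
    refine sum_congr rfl fun s _ => ?_
    rw [sum_sigma]
  let φ : ℕ → (Σ _ : ℕ, Σ _ : ℕ, ℕ) := fun n => ⟨a n, b n, c n⟩
  have hinj : Set.InjOn φ (Icc 1 N : Finset ℕ) := by
    intro k _ l _ hkl
    have e := congrArg (fun q : (Σ _ : ℕ, Σ _ : ℕ, ℕ) => q.1 ^ 2 * q.2.1 * q.2.2) hkl
    simp only [φ] at e
    rwa [← (ht k).1, ← (ht l).1] at e
  have h1 : ∀ n ∈ Icc 1 N, f n ≤ h (φ n).1 (φ n).2.1 (φ n).2.2 ∧ φ n ∈ T := by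
    intro n hn
    have hn := mem_Icc.1 hn
    obtain ⟨e, hg, hc, hsq⟩ := ht n
    have hs0 : a n ≠ 0 := by
      intro h0; rw [h0] at e; simp at e; omega
    have hm0 : c n ≠ 0 := hsq.ne_zero
    have hg0 : b n ≠ 0 := fun h => hs0 (by simpa [h] using hg)
    refine ⟨?_, ?_⟩
    · have := hf _ _ _ hs0 hg hc hsq
      rwa [← e] at this
    · have hpos : 0 < a n ^ 2 * b n := by positivity
      have h2 : a n ≤ n := by
        refine Nat.le_of_dvd (by omega) ?_
        refine (Dvd.intro_left (a n * b n * c n) ?_)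
        rw [eq_comm]; refine e.trans ?_; ring
      simp only [T, φ, mem_sigma, mem_Icc, Nat.mem_divisors]
      refine ⟨⟨by omega, by omega⟩, ⟨hg, hs0⟩, by omega, ?_⟩
      rw [Nat.le_div_iff_mul_le hpos, mul_comm, ← e]
      exact hn.2
  rw [hT]
  calc ∑ n ∈ Icc 1 N, f n ≤ ∑ n ∈ Icc 1 N, h (φ n).1 (φ n).2.1 (φ n).2.2 :=
        sum_le_sum fun n hn => (h1 n hn).1
    _ = ∑ q ∈ (Icc 1 N).image φ, h q.1 q.2.1 q.2.2 := by rw [sum_image hinj]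
    _ ≤ _ := by
      refine sum_le_sum_of_subset_of_nonneg ?_ fun _ _ _ => h0 _ _ _
      intro q hq
      obtain ⟨n, hn, rfl⟩ := mem_image.1 hq
      exact (h1 n hn).2

lemma sum_card_divisors_cube_div_sq_le (N : ℕ) :
    ∑ s ∈ Icc 1 N, (#s.divisors : ℝ) ^ 3 * ((s : ℝ) ^ 2)⁻¹ ≤ 256 := by
  have hτ : ∀ k : ℕ, ∀ n : ℕ, (0 : ℝ) ≤ (#n.divisors : ℝ) ^ k * ((n : ℝ) ^ 2)⁻¹ :=
    fun _ _ => by positivity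
  have hmul : ∀ k a b : ℕ, (#(a * b).divisors : ℝ) ^ k * (((a * b : ℕ) : ℝ) ^ 2)⁻¹ ≤
      ((#a.divisors : ℝ) ^ k * ((a : ℝ) ^ 2)⁻¹) * ((#b.divisors : ℝ) ^ k * ((b : ℝ) ^ 2)⁻¹) := by
    intro k a b
    calc _ ≤ ((#a.divisors : ℝ) * #b.divisors) ^ k * (((a * b : ℕ) : ℝ) ^ 2)⁻¹ := by
          gcongr; exact card_divisors_mul_le a b
      _ = _ := by push_cast; rw [mul_pow, mul_pow, mul_inv]; ring
  have hstep : ∀ k : ℕ, ∑ s ∈ Icc 1 N, (#s.divisors : ℝ) ^ (k + 1) * ((s : ℝ) ^ 2)⁻¹ ≤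
      (∑ s ∈ Icc 1 N, (#s.divisors : ℝ) ^ k * ((s : ℝ) ^ 2)⁻¹) ^ 2 := by
    intro k
    refine le_trans (le_of_eq ?_) (sum_card_divisors_mul_le N (hτ k) (hmul k))
    exact sum_congr rfl fun s _ => by ring
  have h0 : ∀ k : ℕ, 0 ≤ ∑ s ∈ Icc 1 N, (#s.divisors : ℝ) ^ k * ((s : ℝ) ^ 2)⁻¹ :=
    fun k => sum_nonneg fun _ _ => hτ k _
  have e0 : ∑ s ∈ Icc 1 N, (#s.divisors : ℝ) ^ 0 * ((s : ℝ) ^ 2)⁻¹ ≤ 2 := by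
    simpa using sum_inv_sq_le N
  have e1 := (hstep 0).trans (pow_le_pow_left₀ (h0 0) e0 2)
  have e2 := (hstep 1).trans (pow_le_pow_left₀ (h0 1) e1 2)
  have e3 := (hstep 2).trans (pow_le_pow_left₀ (h0 2) e2 2)
  norm_num at e3 ⊢
  exact e3

lemma truncSum_eq_zero {z : ℝ} (hz0 : 0 ≤ z) (hz : z ≤ 1) (n : ℕ) : truncSum z n = 0 := by
  refine sum_eq_zero fun d hd => ?_
  have : (1 : ℝ) ≤ d := by exact_mod_cast Nat.pos_of_mem_divisors hd
  rw [posLog_div_eq_zero hz0 (hz.trans this), mul_zero]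

lemma sum_tailSum_sq_div_le {w z : ℝ} (hw : 0 < w) (hz : w ≤ z) {N : ℕ} (hN : N ≤ w ^ 2) :
    ∑ n ∈ Icc 1 N, tailSum z n ^ 2 / n ≤ 256 * (100 * (1 + log⁺ (N / w)) ^ 2 + 7) := by
  set K := 100 * (1 + log⁺ (N / w)) ^ 2 + 7 with hK
  have hz0 : 0 < z := by linarith
  have hK0 : 0 ≤ K := by positivity
  have hU : ∀ s g j : ℕ, s ≠ 0 → g ∣ s → j ∣ s →
      ∑ m ∈ Icc 1 (N / (s ^ 2 * g)), truncSum (m / (z / j)) m ^ 2 / m ≤ K := by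
    intro s g j hs hg hj
    have hj0 : j ≠ 0 := fun h => hs (by simpa [h] using hj)
    have hg0 : g ≠ 0 := fun h => hs (by simpa [h] using hg)
    have hg1 : (1 : ℝ) ≤ g := by exact_mod_cast Nat.pos_of_ne_zero hg0
    have hs1 : (1 : ℝ) ≤ s := by exact_mod_cast Nat.pos_of_ne_zero hs
    have hj1 : (1 : ℝ) ≤ j := by exact_mod_cast Nat.pos_of_ne_zero hj0
    have hjs : (j : ℝ) ≤ s := by exact_mod_cast Nat.le_of_dvd (Nat.pos_of_ne_zero hs) hj
    set M := N / (s ^ 2 * g)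
    have hM : (M : ℝ) ≤ N / s ^ 2 := by
      calc (M : ℝ) ≤ N / (s ^ 2 * g : ℕ) := Nat.cast_div_le
        _ ≤ N / s ^ 2 := by
          push_cast
          gcongr
          exact le_mul_of_one_le_right (by positivity) hg1
    have hW0 : 0 < z / j := by positivity
    rcases lt_or_ge (M : ℝ) (z / j) with h | h
    · rw [sum_eq_zero]
      · exact hK0
      intro m hm
      have : (m : ℝ) ≤ M := by exact_mod_cast (mem_Icc.1 hm).2
      rw [truncSum_eq_zero (by positivity) (div_le_one_of_le₀ (by linarith) hW0.le)]
      simp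
    have h1 : z * s ^ 2 ≤ N * j := by
      have := h.trans hM
      rwa [div_le_div_iff₀ (by linarith) (by positivity)] at this
    have hNw : (N : ℝ) ≤ w * z := by nlinarith
    have hsz : (s : ℝ) * z ≤ N := by
      have h2 : z * s ^ 2 ≤ N * s := h1.trans (by gcongr)
      nlinarith
    have hsw : (s : ℝ) ≤ w := by
      have : (s : ℝ) * z ≤ w * z := hsz.trans hNw
      exact le_of_mul_le_mul_right this hz0
    have hW : 1 ≤ z / j := by
      rw [le_div_iff₀ (by linarith)]; linarith
    refine (sum_truncSum_sq_div_le hW M).trans ?_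
    have h3 : (M : ℝ) / (z / j) ≤ N / w := by
      calc (M : ℝ) / (z / j) ≤ N / s ^ 2 / (z / j) := by gcongr
        _ = N / z * (j / s ^ 2) := by field_simp
        _ ≤ N / w * 1 := by
          gcongr
          rw [div_le_one (by positivity)]; nlinarith
        _ = N / w := mul_one _
    have h4 : 7 * M / (z / j) ^ 2 ≤ (7 : ℝ) := by
      calc 7 * M / (z / j) ^ 2 ≤ 7 * (N / s ^ 2) / (z / j) ^ 2 := by gcongr
        _ = 7 * (N / z ^ 2 * (j ^ 2 / s ^ 2)) := by field_simp
        _ ≤ 7 * (1 * 1) := by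
          gcongr
          · rw [div_le_one (by positivity)]; nlinarith
          · rw [div_le_one (by positivity)]; gcongr
        _ = 7 := by norm_num
    have h5 : 0 ≤ 1 + log⁺ ((M : ℝ) / (z / j)) := add_nonneg zero_le_one posLog_nonneg
    rw [hK]
    gcongr
  refine (sum_le_sum_sq_mul_mul N (fun n => tailSum z n ^ 2 / n) (fun s g m =>
    #s.divisors * (∑ j ∈ s.divisors, truncSum (m / (z / j)) m ^ 2) / ((s ^ 2 * g * m : ℕ) : ℝ))
    (fun s g m => by positivity) ?_).trans ?_
  · intro s g m hs hg hm hsq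
    gcongr
    exact tailSum_sq_mul_sq_le hs hg hm hsq
  calc _ ≤ ∑ s ∈ Icc 1 N, K * ((#s.divisors : ℝ) ^ 3 * ((s : ℝ) ^ 2)⁻¹) := by
        refine sum_le_sum fun s hs => ?_
        have hs := mem_Icc.1 hs
        have hs1 : (1 : ℝ) ≤ s := by exact_mod_cast hs.1
        calc _ ≤ ∑ g ∈ s.divisors, #s.divisors * ((s : ℝ) ^ 2)⁻¹ * (#s.divisors * K) := by
              refine sum_le_sum fun g hg => ?_
              have hg1 : (1 : ℝ) ≤ g := by exact_mod_cast Nat.pos_of_mem_divisors hg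
              calc _ = #s.divisors * ((s : ℝ) ^ 2 * g)⁻¹ * ∑ j ∈ s.divisors,
                    ∑ m ∈ Icc 1 (N / (s ^ 2 * g)), truncSum (m / (z / j)) m ^ 2 / m := by
                    rw [sum_comm, mul_sum]
                    refine sum_congr rfl fun m _ => ?_
                    rw [← sum_div]
                    push_cast
                    simp only [div_eq_mul_inv, mul_inv]
                    ring
                _ ≤ #s.divisors * ((s : ℝ) ^ 2)⁻¹ * ∑ j ∈ s.divisors, K := by
                    gcongr with j hj
                    · exact le_mul_of_one_le_right (by positivity) hg1
                    · exact hU s g j (by omega) (Nat.dvd_of_mem_divisors hg)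
                        (Nat.dvd_of_mem_divisors hj)
                _ = _ := by rw [sum_const, nsmul_eq_mul]
          _ = _ := by rw [sum_const, nsmul_eq_mul]; ring
    _ = K * ∑ s ∈ Icc 1 N, ((#s.divisors : ℝ) ^ 3 * ((s : ℝ) ^ 2)⁻¹) := by rw [mul_sum]
    _ ≤ K * 256 := by gcongr; exact sum_card_divisors_cube_div_sq_le N
    _ = _ := mul_comm _ _

lemma selbergM_mul_log {w y : ℝ} (hw : 0 < w) (hwy : w < y) {d : ℕ} (hd : 1 ≤ d) :
    selbergM w y d * log (y / w) = log⁺ (y / d) - log⁺ (w / d) := by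
  have hd0 : (0 : ℝ) < d := by exact_mod_cast hd
  have hy : 0 < y := hw.trans hwy
  have hL : log (y / w) ≠ 0 := (log_pos ((one_lt_div hw).2 hwy)).ne'
  rw [selbergM]
  split_ifs with h1 h2
  · rw [posLog_eq_log, posLog_eq_log, log_div hy.ne' hw.ne', log_div hy.ne' hd0.ne',
      log_div hw.ne' hd0.ne']
    · ring
    · rw [abs_of_pos (by positivity)]; exact (one_le_div hd0).2 h1
    · rw [abs_of_pos (by positivity)]; exact (one_le_div hd0).2 (h1.trans hwy.le)
  · rw [div_mul_cancel₀ _ hL, posLog_div_eq_zero hw.le (not_le.1 h1).le, sub_zero,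
      posLog_eq_log]
    rw [abs_of_pos (by positivity)]; exact (one_le_div hd0).2 h2
  · rw [posLog_div_eq_zero hw.le (not_le.1 h1).le, posLog_div_eq_zero hy.le (not_le.1 h2).le]
    simp

lemma selbergDelta_mul_log {w y : ℝ} (hw : 0 < w) (hwy : w < y) (n : ℕ) :
    selbergDelta w y n * log (y / w) = truncSum y n - truncSum w n := by
  rw [selbergDelta, truncSum, truncSum, sum_mul, ← sum_sub_distrib]
  refine sum_congr rfl fun d hd => ?_
  rw [selbergLambda, mul_assoc, selbergM_mul_log hw hwy (Nat.pos_of_mem_divisors hd), mul_sub]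

lemma abs_selbergM_le_one {w y : ℝ} (hw : 0 < w) (hwy : w < y) (d : ℕ) :
    |selbergM w y d| ≤ 1 := by
  have hL : 0 < log (y / w) := log_pos ((one_lt_div hw).2 hwy)
  rw [selbergM]
  split_ifs with h1 h2
  · simp
  · have hd : w < d := not_le.1 h1
    have hd0 : 0 < (d : ℝ) := hw.trans hd
    rw [abs_of_nonneg (div_nonneg (log_nonneg ((one_le_div hd0).2 h2)) hL.le), div_le_one hL]
    have hy : 0 < y := hw.trans hwy
    gcongr
  · simp

lemma abs_selbergDelta_le {w y : ℝ} (hw : 0 < w) (hwy : w < y) (n : ℕ) :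
    |selbergDelta w y n| ≤ #n.divisors := by
  rw [selbergDelta]
  refine (abs_sum_le_sum_abs _ _).trans ?_
  calc _ ≤ ∑ d ∈ n.divisors, (1 : ℝ) := by
        refine sum_le_sum fun d _ => ?_
        rw [selbergLambda, abs_mul]
        refine mul_le_one₀ ?_ (abs_nonneg _) (abs_selbergM_le_one hw hwy d)
        exact_mod_cast ArithmeticFunction.abs_moebius_le_one
    _ = _ := by simp

lemma sum_card_divisors_sq_div_le (N : ℕ) :
    ∑ n ∈ Icc 1 N, (#n.divisors : ℝ) ^ 2 * (n : ℝ)⁻¹ ≤ (1 + log N) ^ 4 := by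
  have h1 : ∑ n ∈ Icc 1 N, (#n.divisors : ℝ) * (n : ℝ)⁻¹ ≤
      (∑ n ∈ Icc 1 N, (n : ℝ)⁻¹) ^ 2 :=
    sum_card_divisors_mul_le N (fun _ => by positivity)
      (fun a b => by push_cast; rw [mul_inv])
  have h2 : ∑ n ∈ Icc 1 N, (#n.divisors : ℝ) * ((#n.divisors : ℝ) * (n : ℝ)⁻¹) ≤
      (∑ n ∈ Icc 1 N, (#n.divisors : ℝ) * (n : ℝ)⁻¹) ^ 2 := by
    refine sum_card_divisors_mul_le N (fun _ => by positivity) fun a b => ?_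
    calc _ ≤ ((#a.divisors : ℝ) * #b.divisors) * (((a * b : ℕ) : ℝ))⁻¹ := by
          gcongr; exact card_divisors_mul_le a b
      _ = _ := by push_cast; rw [mul_inv]; ring
  calc _ = ∑ n ∈ Icc 1 N, (#n.divisors : ℝ) * ((#n.divisors : ℝ) * (n : ℝ)⁻¹) :=
        sum_congr rfl fun _ _ => by ring
    _ ≤ (∑ n ∈ Icc 1 N, (#n.divisors : ℝ) * (n : ℝ)⁻¹) ^ 2 := h2
    _ ≤ ((∑ n ∈ Icc 1 N, (n : ℝ)⁻¹) ^ 2) ^ 2 := by gcongr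
    _ ≤ ((1 + log N) ^ 2) ^ 2 := by gcongr; exact sum_inv_le N
    _ = _ := by ring

lemma log_natFloor_le {x : ℝ} (hx : 1 ≤ x) : log ⌊x⌋₊ ≤ log x :=
  log_le_log (by exact_mod_cast (Nat.one_le_floor_iff x).2 hx) (Nat.floor_le (by linarith))

/-- The mean square of `Δ` when `w ≤ √x`. -/
lemma sum_selbergDelta_sq_div_le_of_sq_le {C₀ w y x : ℝ} (hw : 2 ≤ w) (hwy : w < y) (hyx : y ≤ x)
    (hx : 6 ≤ x) (hL : log (x / w) ≤ C₀ * log (y / w)) (hwx : w ^ 2 ≤ x) :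
    ∑ n ∈ Icc 1 ⌊x⌋₊, selbergDelta w y n ^ 2 / n ≤ 6400 * exp 4 * C₀ ^ 2 := by
  set N := ⌊x⌋₊ with hN
  set L := log (y / w) with hLdef
  have hw0 : 0 < w := by linarith
  have hL0 : 0 < L := log_pos ((one_lt_div hw0).2 hwy)
  have hx0 : 0 < x := by linarith
  have hlx : 1 ≤ log x := by
    rw [le_log_iff_exp_le hx0]; linarith [exp_one_lt_three]
  have h1 : log x ≤ 2 * C₀ * L := by
    have h2 : 2 * log w ≤ log x := by
      have := log_le_log (by positivity) hwx
      rwa [log_pow] at this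
    rw [log_div hx0.ne' hw0.ne'] at hL
    linarith
  have hP : eulerProd (range (N + 1)) ≤ exp 4 * (1 + log x) := by
    have hN2 : 2 ≤ N := Nat.le_floor (by push_cast; linarith)
    refine (eulerProd_range_le hN2).trans ?_
    gcongr
    exact Nat.floor_le hx0.le
  have hF : ∀ z, 1 ≤ z → z ≤ x → ∑ n ∈ Icc 1 N, truncSum z n ^ 2 / n ≤
      400 * exp 4 * log x ^ 2 := by
    intro z hz hzx
    refine (sum_truncSum_const_sq_div_le (by linarith) (Nat.floor_le_floor hzx)).trans ?_
    have h2 : log⁺ z ≤ log x := by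
      rw [posLog_eq_log (by rwa [abs_of_pos (by linarith)])]
      exact log_le_log (by linarith) hzx
    calc _ ≤ exp 4 * (1 + log x) * (100 * (1 + log x)) := by
          have : 0 ≤ log⁺ z := posLog_nonneg
          gcongr
      _ ≤ exp 4 * (2 * log x) * (100 * (2 * log x)) := by gcongr <;> linarith
      _ = _ := by ring
  have h3 : L ^ 2 * ∑ n ∈ Icc 1 N, selbergDelta w y n ^ 2 / n ≤
      2 * ∑ n ∈ Icc 1 N, truncSum y n ^ 2 / n + 2 * ∑ n ∈ Icc 1 N, truncSum w n ^ 2 / n := by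
    rw [mul_sum, mul_sum, mul_sum, ← sum_add_distrib]
    refine sum_le_sum fun n _ => ?_
    calc L ^ 2 * (selbergDelta w y n ^ 2 / n) = (selbergDelta w y n * L) ^ 2 / n := by ring
      _ = (truncSum y n - truncSum w n) ^ 2 / n := by
          rw [hLdef, selbergDelta_mul_log hw0 hwy]
      _ ≤ (2 * truncSum y n ^ 2 + 2 * truncSum w n ^ 2) / n := by
          gcongr; nlinarith [sq_nonneg (truncSum y n + truncSum w n)]
      _ = _ := by ring
  have h4 := hF y (by linarith) hyx
  have h5 := hF w (by linarith) (by linarith)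
  have h6 : L ^ 2 * ∑ n ∈ Icc 1 N, selbergDelta w y n ^ 2 / n ≤
      L ^ 2 * (6400 * exp 4 * C₀ ^ 2) := by
    calc _ ≤ 1600 * exp 4 * log x ^ 2 := by linarith
      _ ≤ 1600 * exp 4 * (2 * C₀ * L) ^ 2 := by gcongr
      _ = _ := by ring
  exact le_of_mul_le_mul_left h6 (by positivity)

/-- The mean square of `Δ` when `w ≥ √x` and `y / w` is not too small. -/
lemma sum_selbergDelta_sq_div_le_of_le_sq {C₀ w y x : ℝ} (hC₀ : 1 ≤ C₀) (hw : 2 ≤ w)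
    (hwy : w < y) (hyx : y ≤ x) (hL : log (x / w) ≤ C₀ * log (y / w)) (hwx : x ≤ w ^ 2)
    (hL1 : 1 ≤ log (y / w)) :
    ∑ n ∈ Icc ⌈w⌉₊ ⌊x⌋₊, selbergDelta w y n ^ 2 / n ≤ 416768 * C₀ ^ 2 := by
  set N := ⌊x⌋₊ with hN
  set L := log (y / w) with hLdef
  have hw0 : 0 < w := by linarith
  have hNx : (N : ℝ) ≤ x := Nat.floor_le (by linarith)
  have hp : log⁺ ((N : ℝ) / w) ≤ C₀ * L := by
    refine le_trans ?_ hL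
    have h1 : 1 ≤ x / w := (one_le_div hw0).2 (by linarith)
    rw [← posLog_eq_log (x := x / w) (by rwa [abs_of_pos (by linarith)])]
    gcongr
  have hCL : 1 ≤ C₀ * L := one_le_mul_of_one_le_of_one_le hC₀ hL1
  have hR : ∀ z, w ≤ z → ∑ n ∈ Icc 1 N, tailSum z n ^ 2 / n ≤ 104192 * (C₀ * L) ^ 2 := by
    intro z hz
    refine (sum_tailSum_sq_div_le hw0 hz (hNx.trans hwx)).trans ?_
    have h0 : 0 ≤ log⁺ ((N : ℝ) / w) := posLog_nonneg
    have h1 : (1 + log⁺ ((N : ℝ) / w)) ^ 2 ≤ (2 * (C₀ * L)) ^ 2 := by gcongr; linarith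
    nlinarith
  have h3 : L ^ 2 * ∑ n ∈ Icc ⌈w⌉₊ N, selbergDelta w y n ^ 2 / n ≤
      2 * ∑ n ∈ Icc 1 N, tailSum y n ^ 2 / n + 2 * ∑ n ∈ Icc 1 N, tailSum w n ^ 2 / n := by
    have h2 : 2 ≤ ⌈w⌉₊ := by
      have : (2 : ℝ) ≤ ⌈w⌉₊ := hw.trans (Nat.le_ceil w)
      exact_mod_cast this
    rw [mul_sum, mul_sum, mul_sum, ← sum_add_distrib]
    refine le_trans ?_ (sum_le_sum_of_subset_of_nonneg
      (Icc_subset_Icc_left (by omega : 1 ≤ ⌈w⌉₊)) fun _ _ _ => by positivity)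
    refine sum_le_sum fun n hn => ?_
    have hn := mem_Icc.1 hn
    calc L ^ 2 * (selbergDelta w y n ^ 2 / n) = (selbergDelta w y n * L) ^ 2 / n := by ring
      _ = (tailSum y n - tailSum w n) ^ 2 / n := by
          rw [hLdef, selbergDelta_mul_log hw0 hwy,
            truncSum_sub_truncSum (by linarith) hw0 (by omega)]
      _ ≤ (2 * tailSum y n ^ 2 + 2 * tailSum w n ^ 2) / n := by
          gcongr; nlinarith [sq_nonneg (tailSum y n + tailSum w n)]
      _ = _ := by ring
  have h4 := hR y hwy.le
  have h5 := hR w le_rfl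
  have h6 : L ^ 2 * ∑ n ∈ Icc ⌈w⌉₊ N, selbergDelta w y n ^ 2 / n ≤
      L ^ 2 * (416768 * C₀ ^ 2) := by
    calc _ ≤ 416768 * (C₀ * L) ^ 2 := by linarith
      _ = _ := by ring
  exact le_of_mul_le_mul_left h6 (by positivity)

/-- The trivial bound, saved by the exponential factor when `y / w` is bounded. -/
lemma sum_selbergDelta_sq_mul_exp_div_le {C₀ Q w y x : ℝ} (hC₀ : 1 ≤ C₀) (hQ : 3 ≤ Q)
    (hw : 2 ≤ w) (hwy : w < y) (hyx : y ≤ x) (hxQ : log x ≤ C₀ * log Q)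
    (hL : log (x / w) ≤ C₀) :
    ∑ n ∈ Icc ⌈w⌉₊ ⌊x⌋₊, selbergDelta w y n ^ 2 * exp (-2 * n * log Q ^ 2 / x) / n ≤
      8 * C₀ ^ 4 * exp (2 * C₀) := by
  have hw0 : 0 < w := by linarith
  have hx0 : 0 < x := by linarith
  have hlQ : 1 ≤ log Q := by
    rw [le_log_iff_exp_le (by linarith)]; linarith [exp_one_lt_three]
  have hwx : exp (-C₀) ≤ w / x := by
    have h1 : x / w ≤ exp C₀ := (log_le_iff_le_exp (by positivity)).1 hL
    rw [exp_neg, ← inv_div]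
    gcongr
  set t := 2 * exp (-C₀) * log Q ^ 2 with ht
  have ht0 : 0 < t := by positivity
  have hexp : exp (-t) ≤ 2 / t ^ 2 := by
    rw [exp_neg, ← inv_div]
    gcongr
    have := quadratic_le_exp_of_nonneg ht0.le
    linarith
  have h1 : ∀ n ∈ Icc ⌈w⌉₊ ⌊x⌋₊, selbergDelta w y n ^ 2 * exp (-2 * n * log Q ^ 2 / x) / n ≤
      2 / t ^ 2 * ((#n.divisors : ℝ) ^ 2 * (n : ℝ)⁻¹) := by
    intro n hn
    have hwn : w ≤ n := Nat.ceil_le.1 (mem_Icc.1 hn).1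
    have h2 : -2 * n * log Q ^ 2 / x ≤ -t := by
      have h3 : exp (-C₀) ≤ n / x := hwx.trans (by gcongr)
      have h4 : t ≤ 2 * (n / x) * log Q ^ 2 := by rw [ht]; gcongr
      have h5 : -2 * n * log Q ^ 2 / x = -(2 * (n / x) * log Q ^ 2) := by ring
      linarith
    have h6 : selbergDelta w y n ^ 2 ≤ (#n.divisors : ℝ) ^ 2 := by
      rw [← sq_abs]
      gcongr
      exact abs_selbergDelta_le hw0 hwy n
    calc _ ≤ (#n.divisors : ℝ) ^ 2 * (2 / t ^ 2) / n := by
          gcongr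
          exact (exp_le_exp.2 h2).trans hexp
      _ = _ := by ring
  have h7 : log ⌊x⌋₊ ≤ C₀ * log Q := (log_natFloor_le (by linarith)).trans hxQ
  have hCQ : 1 ≤ C₀ * log Q := one_le_mul_of_one_le_of_one_le hC₀ hlQ
  have h0 : 0 ≤ log ⌊x⌋₊ := log_natCast_nonneg _
  calc _ ≤ ∑ n ∈ Icc ⌈w⌉₊ ⌊x⌋₊, 2 / t ^ 2 * ((#n.divisors : ℝ) ^ 2 * (n : ℝ)⁻¹) :=
        sum_le_sum h1
    _ ≤ ∑ n ∈ Icc 1 ⌊x⌋₊, 2 / t ^ 2 * ((#n.divisors : ℝ) ^ 2 * (n : ℝ)⁻¹) :=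
        sum_le_sum_of_subset_of_nonneg (Icc_subset_Icc_left (Nat.one_le_ceil_iff.2 hw0))
          fun _ _ _ => by positivity
    _ = 2 / t ^ 2 * ∑ n ∈ Icc 1 ⌊x⌋₊, ((#n.divisors : ℝ) ^ 2 * (n : ℝ)⁻¹) := by rw [mul_sum]
    _ ≤ 2 / t ^ 2 * (1 + log ⌊x⌋₊) ^ 4 := by gcongr; exact sum_card_divisors_sq_div_le _
    _ ≤ 2 / t ^ 2 * (2 * (C₀ * log Q)) ^ 4 := by gcongr; linarith
    _ = 8 * C₀ ^ 4 * exp (2 * C₀) := by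
        have h8 : exp (2 * C₀) = (exp (-C₀) ^ 2)⁻¹ := by
          rw [← exp_nat_mul, ← exp_neg]; congr 1; push_cast; ring
        rw [h8, ht]
        field_simp
        norm_num

lemma sum_selbergDelta_sq_mul_exp_div_le_const {C₀ Q R w y x : ℝ} (hC₀ : 1 ≤ C₀) (hQ : 3 ≤ Q)
    (hR : 2 ≤ R) (hw : 2 ≤ w) (hwy : w < y) (hyx : y ≤ x) (hQR : Q * R ≤ x)
    (hxQ : log x ≤ C₀ * log Q) (hL : log (x / w) ≤ C₀ * log (y / w)) :
    ∑ n ∈ Icc ⌈w⌉₊ ⌊x⌋₊, selbergDelta w y n ^ 2 * exp (-2 * n * log Q ^ 2 / x) / n ≤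
      6400 * exp 4 * C₀ ^ 2 + 416768 * C₀ ^ 2 + 8 * C₀ ^ 4 * exp (2 * C₀) := by
  have hw0 : 0 < w := by linarith
  have hx0 : 0 < x := by linarith
  have ha : 0 ≤ 6400 * exp 4 * C₀ ^ 2 := by positivity
  have hb : 0 ≤ 416768 * C₀ ^ 2 := by positivity
  have hc : 0 ≤ 8 * C₀ ^ 4 * exp (2 * C₀) := by positivity
  have hdrop : ∑ n ∈ Icc ⌈w⌉₊ ⌊x⌋₊, selbergDelta w y n ^ 2 * exp (-2 * n * log Q ^ 2 / x) / n ≤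
      ∑ n ∈ Icc ⌈w⌉₊ ⌊x⌋₊, selbergDelta w y n ^ 2 / n := by
    refine sum_le_sum fun n _ => ?_
    gcongr
    refine mul_le_of_le_one_right (sq_nonneg _) (exp_le_one_iff.2 ?_)
    refine div_nonpos_of_nonpos_of_nonneg ?_ hx0.le
    have : 0 ≤ (n : ℝ) * log Q ^ 2 := by positivity
    linarith
  rcases le_total (w ^ 2) x with h | h
  · have h1 := sum_selbergDelta_sq_div_le_of_sq_le hw hwy hyx (by nlinarith) hL h
    have h2 : ∑ n ∈ Icc ⌈w⌉₊ ⌊x⌋₊, selbergDelta w y n ^ 2 / n ≤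
        ∑ n ∈ Icc 1 ⌊x⌋₊, selbergDelta w y n ^ 2 / n :=
      sum_le_sum_of_subset_of_nonneg (Icc_subset_Icc_left (Nat.one_le_ceil_iff.2 hw0))
        fun _ _ _ => by positivity
    linarith
  rcases le_total 1 (log (y / w)) with h1 | h1
  · have := sum_selbergDelta_sq_div_le_of_le_sq hC₀ hw hwy hyx hL h h1
    linarith
  · have := sum_selbergDelta_sq_mul_exp_div_le hC₀ hQ hw hwy hyx hxQ
      (hL.trans (mul_le_of_le_one_right (by linarith) h1))
    linarith

end BarbanVehov

/-- For every real `C₀ ≥ 1` there exists `C > 0`, depending only on `C₀`,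
such that for all `Q ≥ 3`, `R ≥ 2`, reals `2 ≤ w < y ≤ x` with `Q·R ≤ x ≤ Q^{C₀}` and
`log(x/w) ≤ C₀·log(y/w)`, and every `α` with `3/4 ≤ α < 1`,
`log(Qx)·(1 + log(log x / log(QR)))·∑_{w ≤ n ≤ x} Δ(n)²·e^{−2n(log Q)²/x}·n^{1−2α}
  ≤ C·(log Q)·x^{2(1−α)}`. -/
theorem stmt7 (C₀ : ℝ) (hC₀ : 1 ≤ C₀) :
    ∃ C : ℝ, 0 < C ∧
      ∀ Q R w y x α : ℝ,
        3 ≤ Q → 2 ≤ R → 2 ≤ w → w < y → y ≤ x → Q * R ≤ x → x ≤ Q ^ C₀ →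
        Real.log (x / w) ≤ C₀ * Real.log (y / w) →
        3 / 4 ≤ α → α < 1 →
        Real.log (Q * x) * (1 + Real.log (Real.log x / Real.log (Q * R))) *
            ∑ n ∈ Finset.Icc (Nat.ceil w) (Nat.floor x),
              selbergDelta w y n ^ 2 * Real.exp (-2 * n * Real.log Q ^ 2 / x) *
                (n : ℝ) ^ (1 - 2 * α) ≤
          C * Real.log Q * x ^ (2 * (1 - α)) := by
  have hK : 0 < 6400 * Real.exp 4 * C₀ ^ 2 + 416768 * C₀ ^ 2 + 8 * C₀ ^ 4 * Real.exp (2 * C₀) := by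
    positivity
  set K := 6400 * Real.exp 4 * C₀ ^ 2 + 416768 * C₀ ^ 2 + 8 * C₀ ^ 4 * Real.exp (2 * C₀)
  have hlC : 0 ≤ Real.log C₀ := Real.log_nonneg hC₀
  refine ⟨(1 + C₀) * (1 + Real.log C₀) * K, by positivity, ?_⟩
  intro Q R w y x α hQ hR hw hwy hyx hQR hxQ hL _ hα
  have hQ0 : 0 < Q := by linarith
  have hx0 : 0 < x := by linarith
  have hlQ : 0 < Real.log Q := Real.log_pos (by linarith)
  have hlx : Real.log x ≤ C₀ * Real.log Q := by
    rw [← Real.log_rpow hQ0]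
    exact Real.log_le_log hx0 hxQ
  have hlQR : Real.log Q ≤ Real.log (Q * R) :=
    Real.log_le_log hQ0 (le_mul_of_one_le_right hQ0.le (by linarith))
  have hlQRx : Real.log (Q * R) ≤ Real.log x := Real.log_le_log (by positivity) hQR
  have h1 : Real.log (Q * x) ≤ (1 + C₀) * Real.log Q := by
    rw [Real.log_mul hQ0.ne' hx0.ne']
    linarith
  have h2 : 1 ≤ Real.log x / Real.log (Q * R) := (one_le_div (by linarith)).2 hlQRx
  have h3 : Real.log x / Real.log (Q * R) ≤ C₀ := by
    rw [div_le_iff₀ (by linarith)]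
    exact hlx.trans (by gcongr)
  have h4 : Real.log (Real.log x / Real.log (Q * R)) ≤ Real.log C₀ :=
    Real.log_le_log (by linarith) h3
  have h5 : 0 ≤ Real.log (Real.log x / Real.log (Q * R)) := Real.log_nonneg h2
  have h6 := BarbanVehov.sum_selbergDelta_sq_mul_exp_div_le_const hC₀ hQ hR hw hwy hyx hQR hlx hL
  have h7 : ∑ n ∈ Finset.Icc (Nat.ceil w) (Nat.floor x),
      selbergDelta w y n ^ 2 * Real.exp (-2 * n * Real.log Q ^ 2 / x) * (n : ℝ) ^ (1 - 2 * α) ≤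
      x ^ (2 * (1 - α)) * K := by
    refine le_trans ?_ (mul_le_mul_of_nonneg_left h6 (by positivity))
    rw [Finset.mul_sum]
    refine Finset.sum_le_sum fun n hn => ?_
    have hn := Finset.mem_Icc.1 hn
    have hwn : w ≤ n := Nat.ceil_le.1 hn.1
    have hnx : (n : ℝ) ≤ x := (Nat.le_floor_iff hx0.le).1 hn.2
    have hn0 : (0 : ℝ) < n := by linarith
    have h8 : (n : ℝ) ^ (1 - 2 * α) = (n : ℝ) ^ (2 * (1 - α)) / n := by
      rw [← Real.rpow_sub_one hn0.ne']
      congr 1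
      ring
    have h9 : (n : ℝ) ^ (2 * (1 - α)) ≤ x ^ (2 * (1 - α)) :=
      Real.rpow_le_rpow hn0.le hnx (by linarith)
    rw [h8]
    calc _ ≤ selbergDelta w y n ^ 2 * Real.exp (-2 * n * Real.log Q ^ 2 / x) *
          (x ^ (2 * (1 - α)) / n) := by gcongr
      _ = _ := by ring
  have h10 : 0 ≤ Real.log (Q * x) := Real.log_nonneg (by nlinarith)
  calc _ ≤ ((1 + C₀) * Real.log Q) * (1 + Real.log C₀) * (x ^ (2 * (1 - α)) * K) := by
        gcongr
    _ = _ := by ring
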